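/- Let p ∈ (1,∞), s ∈ (0,1), and let v ∈ W^{s,p}(ℝⁿ) be a weak solution of the homogeneous Dirichlet problem −L_Φ v = 0 in Ω, v = g on ℝⁿ∖Ω. Let B_r(x₀) ⊂ Ω. Then for every σ ∈ (0,1), sup_{B_{σr}(x₀)} |v| ≤ c (1−σ)^{−np/(p−1)} [ ⨍_{B_r(x₀)} |v| dx + Tail(v; x₀, r/2) ], with c depending only on n, s, p, Λ. -/

import Mathlib

noncomputable section

open MeasureTheory Metric Set Filter Topology
open scoped ENNReal NNReal

/-- Euclidean space `ℝⁿ`. -/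
abbrev Rn (n : ℕ) : Type := EuclideanSpace ℝ (Fin n)

/-- `q_* = max {1, p-1}`. -/
def qStar (p : ℝ) : ℝ := max 1 (p - 1)

/-- `q̄ = min {n(p-1)/(n-s), p}`. -/
def qBar (n : ℕ) (s p : ℝ) : ℝ := min ((n : ℝ) * (p - 1) / ((n : ℝ) - s)) p

/-- Gagliardo seminorm raised to the power `p`, as an `ℝ≥0∞`-valued double integral. -/
def gagliardo (n : ℕ) (s p : ℝ) (O : Set (Rn n)) (v : Rn n → ℝ) : ℝ≥0∞ :=
  ∫⁻ x in O, ∫⁻ y in O, ENNReal.ofReal (|v x - v y| ^ p / ‖x - y‖ ^ ((n : ℝ) + s * p))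

/-- `v ∈ W^{s,p}(O)`. -/
def memWsp (n : ℕ) (s p : ℝ) (O : Set (Rn n)) (v : Rn n → ℝ) : Prop :=
  AEMeasurable v (volume.restrict O) ∧
    (∫⁻ x in O, ENNReal.ofReal (|v x| ^ p)) < ⊤ ∧ gagliardo n s p O v < ⊤

/-- `Tail(v; x₀, r)`. -/
def tailFn (n : ℕ) (s p : ℝ) (v : Rn n → ℝ) (x₀ : Rn n) (r : ℝ) : ℝ≥0∞ :=
  (ENNReal.ofReal (r ^ (s * p)) *
      ∫⁻ x in (ball x₀ r)ᶜ,
        ENNReal.ofReal (|v x| ^ (p - 1) / ‖x - x₀‖ ^ ((n : ℝ) + s * p))) ^ (1 / (p - 1))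

/-- `v ∈ L^{p-1}_{sp}(ℝⁿ)`. -/
def memTailSpace (n : ℕ) (s p : ℝ) (v : Rn n → ℝ) : Prop :=
  AEMeasurable v (volume : Measure (Rn n)) ∧
    (∀ R : ℝ, (∫⁻ x in ball (0 : Rn n) R, ENNReal.ofReal (|v x| ^ (p - 1))) < ⊤) ∧
    ∀ z : Rn n, ∀ r : ℝ, 0 < r → tailFn n s p v z r < ⊤

/-- `φ ∈ C_0^∞(O)`. -/
def IsTestFun (n : ℕ) (O : Set (Rn n)) (φ : Rn n → ℝ) : Prop :=
  ContDiff ℝ (⊤ : ℕ∞) φ ∧ HasCompactSupport φ ∧ tsupport φ ⊆ O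

/-- The nonlocal form `⟨-L_Φ u, φ⟩`. -/
def nonlocalForm (n : ℕ) (Φ : ℝ → ℝ) (K : Rn n → Rn n → ℝ) (u φ : Rn n → ℝ) : ℝ :=
  ∫ x : Rn n, ∫ y : Rn n, Φ (u x - u y) * (φ x - φ y) * K x y

/-- Ellipticity/coercivity bounds on the kernel `K`. -/
def KernelBounds (n : ℕ) (Λ s p : ℝ) (K : Rn n → Rn n → ℝ) : Prop :=
  Measurable (Function.uncurry K) ∧
    ∀ x y : Rn n, x ≠ y →
      1 / (Λ * ‖x - y‖ ^ ((n : ℝ) + s * p)) ≤ K x y ∧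
        K x y ≤ Λ / ‖x - y‖ ^ ((n : ℝ) + s * p)

/-- Structure conditions on `Φ`. -/
def PhiBounds (Λ p : ℝ) (Φ : ℝ → ℝ) : Prop :=
  Continuous Φ ∧ Φ 0 = 0 ∧
    ∀ t : ℝ, |t| ^ p / Λ ≤ Φ t * t ∧ Φ t * t ≤ Λ * |t| ^ p

/-- `∫ φ dμ` for a signed measure `μ`. -/
def sintegral (n : ℕ) (μ : MeasureTheory.SignedMeasure (Rn n)) (φ : Rn n → ℝ) : ℝ :=
  (∫ x, φ x ∂μ.toJordanDecomposition.posPart) -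
    ∫ x, φ x ∂μ.toJordanDecomposition.negPart

/-- Weak (energy) solution of `-L_Φ u = f` in `Ω`, `u = g` on `ℝⁿ ∖ Ω`. -/
def WeakSol (n : ℕ) (Φ : ℝ → ℝ) (K : Rn n → Rn n → ℝ) (s p : ℝ)
    (Ω : Set (Rn n)) (f g u : Rn n → ℝ) : Prop :=
  memWsp n s p univ u ∧ (∀ᵐ x : Rn n, x ∉ Ω → u x = g x) ∧
    ∀ φ : Rn n → ℝ, IsTestFun n Ω φ → nonlocalForm n Φ K u φ = ∫ x : Rn n, φ x * f x

/-- Weak subsolution of the homogeneous equation `-L_Φ w = 0` in `Ω`. -/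
def WeakSubSol (n : ℕ) (Φ : ℝ → ℝ) (K : Rn n → Rn n → ℝ) (s p : ℝ)
    (Ω : Set (Rn n)) (w : Rn n → ℝ) : Prop :=
  memWsp n s p univ w ∧
    ∀ φ : Rn n → ℝ, IsTestFun n Ω φ → (∀ x, 0 ≤ φ x) → nonlocalForm n Φ K w φ ≤ 0

/-- The approximation properties required of a SOLA. -/
def SOLAApprox (n : ℕ) (Φ : ℝ → ℝ) (K : Rn n → Rn n → ℝ) (s p : ℝ)
    (Ω : Set (Rn n)) (μ : MeasureTheory.SignedMeasure (Rn n)) (g u : Rn n → ℝ)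
    (uj μj gj : ℕ → Rn n → ℝ) : Prop :=
  (∀ j, ContDiff ℝ (⊤ : ℕ∞) (μj j) ∧ HasCompactSupport (μj j)) ∧
  (∀ j, ContDiff ℝ (⊤ : ℕ∞) (gj j) ∧ HasCompactSupport (gj j)) ∧
  (∀ j, WeakSol n Φ K s p Ω (μj j) (gj j) (uj j)) ∧
  (∀ᵐ x : Rn n, Tendsto (fun j => uj j x) atTop (𝓝 (u x))) ∧
  (∀ q : ℝ, qStar p ≤ q → q < qBar n s p → ∀ z : Rn n, ∀ r : ℝ, 0 < r →
    Tendsto (fun j => ∫⁻ x in ball z r, ENNReal.ofReal (|uj j x - u x| ^ q)) atTop (𝓝 0)) ∧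
  (∀ φ : Rn n → ℝ, Continuous φ → HasCompactSupport φ → tsupport φ ⊆ Ω →
    Tendsto (fun j => ∫ x : Rn n, φ x * μj j x) atTop (𝓝 (sintegral n μ φ))) ∧
  (∀ z : Rn n, ∀ r : ℝ, 0 < r →
    Filter.limsup (fun j => ∫⁻ x in ball z r, ENNReal.ofReal |μj j x|) atTop
      ≤ μ.totalVariation (closedBall z r)) ∧
  (∀ z : Rn n, ∀ r : ℝ, 0 < r →
    Tendsto (fun j =>
        (∫⁻ x in ball z r, ENNReal.ofReal (|gj j x - g x| ^ p)) +
          gagliardo n s p (ball z r) (fun x => gj j x - g x)) atTop (𝓝 0) ∧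
      Tendsto (fun j => tailFn n s p (fun x => gj j x - g x) z r) atTop (𝓝 0))

/-- SOLA of the Dirichlet problem `-L_Φ u = μ` in `Ω`, `u = g` on `ℝⁿ ∖ Ω`. -/
def IsSOLA (n : ℕ) (Φ : ℝ → ℝ) (K : Rn n → Rn n → ℝ) (s p : ℝ)
    (Ω : Set (Rn n)) (μ : MeasureTheory.SignedMeasure (Rn n)) (g u : Rn n → ℝ) : Prop :=
  (∀ h q : ℝ, 0 < h → h < s → qStar p ≤ q → q < qBar n s p → memWsp n h q Ω u) ∧
  (∀ φ : Rn n → ℝ, IsTestFun n Ω φ → nonlocalForm n Φ K u φ = sintegral n μ φ) ∧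
  (∀ᵐ x : Rn n, x ∉ Ω → u x = g x) ∧
  ∃ uj μj gj : ℕ → Rn n → ℝ, SOLAApprox n Φ K s p Ω μ g u uj μj gj

/-- Truncated Wolff potential `W^ν_{s,p}(x₀, r)`. -/
def wolff (n : ℕ) (s p : ℝ) (ν : Measure (Rn n)) (x₀ : Rn n) (r : ℝ) : ℝ≥0∞ :=
  ∫⁻ ρ in Ioc (0 : ℝ) r,
    (ν (ball x₀ ρ) / ENNReal.ofReal (ρ ^ ((n : ℝ) - s * p))) ^ (1 / (p - 1)) /
      ENNReal.ofReal ρ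

/-- Integral average of `u` over `B_r(x₀)`. -/
def ballAvg (n : ℕ) (u : Rn n → ℝ) (x₀ : Rn n) (r : ℝ) : ℝ :=
  ⨍ x in ball x₀ r, u x

/-- Local excess `A(f; x₀, r)`. -/
def locExcess (n : ℕ) (p : ℝ) (f : Rn n → ℝ) (x₀ : Rn n) (r : ℝ) : ℝ≥0∞ :=
  ((volume (ball x₀ r))⁻¹ *
      ∫⁻ x in ball x₀ r, ENNReal.ofReal (|f x - ballAvg n f x₀ r| ^ qStar p)) ^ (1 / qStar p)

/-- Global excess `E(f; x₀, r)`. -/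
def excess (n : ℕ) (s p : ℝ) (f : Rn n → ℝ) (x₀ : Rn n) (r : ℝ) : ℝ≥0∞ :=
  locExcess n p f x₀ r + tailFn n s p (fun x => f x - ballAvg n f x₀ r) x₀ r

/-- `g ∈ W^{s,p}_loc(ℝⁿ) ∩ L^{p-1}_{sp}(ℝⁿ)`. -/
def BoundaryDatum (n : ℕ) (s p : ℝ) (g : Rn n → ℝ) : Prop :=
  (∀ z : Rn n, ∀ r : ℝ, 0 < r → memWsp n s p (ball z r) g) ∧ memTailSpace n s p g

/-- Symmetric measurable kernel with ellipticity bounds. -/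
def SymKernel (n : ℕ) (Λ s p : ℝ) (Kt : Rn n → Rn n → ℝ) : Prop :=
  KernelBounds n Λ s p Kt ∧ ∀ x y : Rn n, Kt x y = Kt y x

/-- Weak solution of the kernel-`Kt` fractional `p`-Laplace equation with datum `f` in `O`. -/
def WeakSolP (n : ℕ) (Kt : Rn n → Rn n → ℝ) (s p : ℝ) (O : Set (Rn n))
    (f u : Rn n → ℝ) : Prop :=
  memWsp n s p univ u ∧
    ∀ φ : Rn n → ℝ, IsTestFun n O φ →
      (∫ x : Rn n, ∫ y : Rn n,
          |u x - u y| ^ (p - 2) * (u x - u y) * (φ x - φ y) * Kt x y) =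
        ∫ x : Rn n, φ x * f x

/-! ### Elementary inequalities -/

lemma rpow_sub_rpow_le {p x y : ℝ} (hp : 1 ≤ p) (hy : 0 ≤ y) (hyx : y ≤ x) :
    x ^ p - y ^ p ≤ p * x ^ (p - 1) * (x - y) := by
  rcases eq_or_lt_of_le (hy.trans hyx) with hx | hx
  · have : y = 0 := by linarith
    subst this
    simp [← hx]
  · have h := one_add_mul_self_le_rpow_one_add (s := y / x - 1) (p := p)
      (by have := div_nonneg hy hx.le; linarith) hp
    have h1 : (1 + (y / x - 1)) ^ p = y ^ p / x ^ p := by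
      rw [← Real.div_rpow hy hx.le]; ring_nf
    rw [h1] at h
    have hxp : 0 < x ^ p := Real.rpow_pos_of_pos hx p
    rw [le_div_iff₀ hxp] at h
    have h2 : x ^ (p - 1) = x ^ p / x := by rw [Real.rpow_sub_one hx.ne']
    rw [h2]
    have h3 : p * (x ^ p / x) * (x - y) = - (p * (y / x - 1)) * x ^ p := by
      field_simp; ring
    rw [h3]; nlinarith

lemma abs_rpow_sub_rpow_le {p x y : ℝ} (hp : 1 ≤ p) (hx : 0 ≤ x) (hx1 : x ≤ 1)
    (hy : 0 ≤ y) (hy1 : y ≤ 1) : |x ^ p - y ^ p| ≤ p * |x - y| := by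
  wlog h : y ≤ x generalizing x y
  · rw [abs_sub_comm, abs_sub_comm x]
    exact this hy hy1 hx hx1 (le_of_not_ge h)
  · rw [abs_of_nonneg (sub_nonneg.2 h),
      abs_of_nonneg (sub_nonneg.2 (Real.rpow_le_rpow hy h (by linarith)))]
    refine (rpow_sub_rpow_le hp hy h).trans ?_
    have : x ^ (p - 1) ≤ 1 := Real.rpow_le_one hx hx1 (by linarith)
    have h0 : 0 ≤ x - y := by linarith
    have hp0 : 0 ≤ p := by linarith
    calc p * x ^ (p - 1) * (x - y) ≤ p * 1 * (x - y) := by gcongr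
      _ = _ := by ring

/-- The algebraic inequality behind the Caccioppoli estimate. -/
lemma cutoff_inequality {p a b ξ ζ : ℝ} (hp : 1 < p) (hb : 0 ≤ b) (hba : b ≤ a)
    (hξ : 0 ≤ ξ) (hζ : 0 ≤ ζ) :
    (a - b) ^ (p - 1) * (b * ζ ^ p - a * ξ ^ p) ≤ p ^ p * a ^ p * |ξ - ζ| ^ p := by
  have ha : 0 ≤ a := hb.trans hba
  have hp0 : 0 < p := by linarith
  have hR : 0 ≤ p ^ p * a ^ p * |ξ - ζ| ^ p := by positivity
  rcases le_or_gt (b * ζ ^ p) (a * ξ ^ p) with h | h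
  · refine le_trans (mul_nonpos_of_nonneg_of_nonpos ?_ (by linarith)) hR
    exact Real.rpow_nonneg (by linarith) _
  have ha0 : 0 < a := by
    rcases eq_or_lt_of_le ha with h0 | h0
    · have : b = 0 := by linarith
      subst this; rw [← h0] at h; simp at h
    · exact h0
  set θ := (b / a) ^ (1 / p) with hθ
  have hba0 : 0 ≤ b / a := by positivity
  have hθ0 : 0 ≤ θ := Real.rpow_nonneg hba0 _
  have hθp : θ ^ p = b / a := by
    rw [hθ, ← Real.rpow_mul hba0, one_div, inv_mul_cancel₀ hp0.ne', Real.rpow_one]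
  have hθ1 : θ ≤ 1 := Real.rpow_le_one hba0 (by rw [div_le_one ha0]; exact hba) (by positivity)
  have hb' : b = a * θ ^ p := by rw [hθp, ← mul_div_assoc, mul_div_cancel_left₀ _ ha0.ne']
  have hζθ : (θ * ζ) ^ p = θ ^ p * ζ ^ p := Real.mul_rpow hθ0 hζ
  have hlt : ξ < θ * ζ := by
    have : ξ ^ p < (θ * ζ) ^ p := by
      rw [hζθ, hθp]
      have : ξ ^ p < b * ζ ^ p / a := by rw [lt_div_iff₀ ha0]; linarith
      calc ξ ^ p < b * ζ ^ p / a := this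
        _ = _ := by ring
    exact lt_of_not_ge fun hh => absurd (Real.rpow_le_rpow (by positivity) hh hp0.le) (not_le.2 this)
  have hle : θ * ζ ≤ ζ := by nlinarith
  have e1 : (a - b) ^ (p - 1) ≤ a ^ (p - 1) * (p ^ (p - 1) * (1 - θ) ^ (p - 1)) := by
    have h1 : 1 - θ ^ p ≤ p * (1 - θ) := by
      have := rpow_sub_rpow_le hp.le hθ0 hθ1
      simpa using this
    have h2 : a - b ≤ a * (p * (1 - θ)) := by rw [hb']; nlinarith
    calc (a - b) ^ (p - 1) ≤ (a * (p * (1 - θ))) ^ (p - 1) :=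
          Real.rpow_le_rpow (by linarith) h2 (by linarith)
      _ = _ := by
          rw [Real.mul_rpow ha (mul_nonneg hp0.le (by linarith)),
            Real.mul_rpow hp0.le (by linarith)]
  have e2 : b * ζ ^ p - a * ξ ^ p ≤ a * (p * ζ ^ (p - 1) * |ξ - ζ|) := by
    have h1 := rpow_sub_rpow_le hp.le hξ hlt.le
    have h2 : (θ * ζ) ^ (p - 1) ≤ ζ ^ (p - 1) :=
      Real.rpow_le_rpow (by positivity) hle (by linarith)
    have h3 : θ * ζ - ξ ≤ |ξ - ζ| := by rw [abs_sub_comm]; exact (by linarith : _ ≤ ζ - ξ).trans (le_abs_self _)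
    have h4 : p * (θ * ζ) ^ (p - 1) * (θ * ζ - ξ) ≤ p * ζ ^ (p - 1) * |ξ - ζ| := by
      gcongr
    have h5 : b * ζ ^ p - a * ξ ^ p = a * ((θ * ζ) ^ p - ξ ^ p) := by rw [hζθ, hb']; ring
    rw [h5]; exact mul_le_mul_of_nonneg_left (h1.trans h4) ha
  have e3 : (1 - θ) ^ (p - 1) * ζ ^ (p - 1) ≤ |ξ - ζ| ^ (p - 1) := by
    rw [← Real.mul_rpow (by linarith) hζ]
    refine Real.rpow_le_rpow (mul_nonneg (by linarith) hζ) ?_ (by linarith)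
    rw [abs_sub_comm]; exact le_trans (by nlinarith) (le_abs_self _)
  have hpow : ∀ x : ℝ, 0 ≤ x → x ^ p = x ^ (p - 1) * x := fun x hx => by
    rcases eq_or_lt_of_le hx with h0 | h0
    · rw [← h0]; simp [Real.zero_rpow hp0.ne']
    · rw [Real.rpow_sub_one h0.ne']; field_simp
  have hξζ : 0 ≤ |ξ - ζ| := abs_nonneg _
  calc (a - b) ^ (p - 1) * (b * ζ ^ p - a * ξ ^ p)
      ≤ (a ^ (p - 1) * (p ^ (p - 1) * (1 - θ) ^ (p - 1))) * (a * (p * ζ ^ (p - 1) * |ξ - ζ|)) := by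
        refine mul_le_mul e1 e2 (by linarith) ?_
        have : 0 ≤ (1 - θ) ^ (p - 1) := Real.rpow_nonneg (by linarith) _
        positivity
    _ = p ^ p * a ^ p * (((1 - θ) ^ (p - 1) * ζ ^ (p - 1)) * |ξ - ζ|) := by
        rw [hpow a ha, hpow p hp0.le]; ring
    _ ≤ p ^ p * a ^ p * (|ξ - ζ| ^ (p - 1) * |ξ - ζ|) := by gcongr
    _ = _ := by rw [← hpow _ hξζ]

/-- Pointwise estimates of `f (a ξ^p - b ζ^p)` with `a = (V - k)₊`, `b = (U - k)₊`, `U ≤ V`. -/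
lemma ordered_pair_estimates {p Λ k V U ξ ζ f : ℝ} (hp : 1 < p) (hΛ : 1 ≤ Λ) (hUV : U ≤ V)
    (hξ : 0 ≤ ξ) (hζ : 0 ≤ ζ)
    (hf : (V - U) ^ (p - 1) / Λ ≤ f) (hf' : f ≤ Λ * (V - U) ^ (p - 1)) :
    (-(Λ * p ^ p * (max (V - k) 0 ^ p + max (U - k) 0 ^ p) * |ξ - ζ| ^ p)
      ≤ f * (max (V - k) 0 * ξ ^ p - max (U - k) 0 * ζ ^ p)) ∧
    (U ≤ k → max (V - k) 0 ^ p * ξ ^ p / Λ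
      ≤ f * (max (V - k) 0 * ξ ^ p - max (U - k) 0 * ζ ^ p)) ∧
    (ξ = 0 → -(Λ * max (V - k) 0 ^ (p - 1) * (max (U - k) 0 * ζ ^ p))
      ≤ f * (max (V - k) 0 * ξ ^ p - max (U - k) 0 * ζ ^ p)) := by
  have hp0 : 0 < p := by linarith
  have hΛ0 : 0 < Λ := by linarith
  have ht : 0 ≤ V - U := by linarith
  have hf0 : 0 ≤ f := le_trans (by positivity) hf
  set a := max (V - k) 0 with ha
  set b := max (U - k) 0 with hb
  have ha0 : 0 ≤ a := le_max_right _ _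
  have hb0 : 0 ≤ b := le_max_right _ _
  have hba : b ≤ a := max_le_max (by linarith) le_rfl
  have hbz : U ≤ k → b = 0 := fun h => max_eq_right (by linarith)
  have htab : k < U → V - U = a - b := fun h => by
    rw [ha, hb, max_eq_left (by linarith), max_eq_left (by linarith)]; ring
  have hξp : 0 ≤ ξ ^ p := by positivity
  have hζp : 0 ≤ ζ ^ p := by positivity
  refine ⟨?_, ?_, ?_⟩
  · have hneg : -(Λ * p ^ p * (a ^ p + b ^ p) * |ξ - ζ| ^ p) ≤ 0 := by
      have : 0 ≤ Λ * p ^ p * (a ^ p + b ^ p) * |ξ - ζ| ^ p := by positivity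
      linarith
    rcases le_or_gt (b * ζ ^ p) (a * ξ ^ p) with h | h
    · exact hneg.trans (mul_nonneg hf0 (by linarith))
    rcases le_or_gt U k with hk | hk
    · rw [hbz hk] at h; simp at h; exact absurd h (not_lt.2 (by positivity))
    have h1 := cutoff_inequality hp hb0 hba hξ hζ
    rw [htab hk] at hf'
    have h2 : f * (b * ζ ^ p - a * ξ ^ p) ≤ Λ * (a - b) ^ (p - 1) * (b * ζ ^ p - a * ξ ^ p) :=
      mul_le_mul_of_nonneg_right hf' (by linarith)
    have h3 : Λ * ((a - b) ^ (p - 1) * (b * ζ ^ p - a * ξ ^ p)) ≤ Λ * (p ^ p * a ^ p * |ξ - ζ| ^ p) := by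
      gcongr
    have h4 : 0 ≤ Λ * p ^ p * b ^ p * |ξ - ζ| ^ p := by positivity
    nlinarith
  · intro hk
    rw [hbz hk]
    rcases le_or_gt V k with hVk | hVk
    · have : a = 0 := max_eq_right (by linarith)
      rw [this]; simp [Real.zero_rpow hp0.ne']
    have haV : a = V - k := max_eq_left (by linarith)
    have ha1 : 0 < a := by rw [haV]; linarith
    have hat : a ^ (p - 1) / Λ ≤ f := by
      refine le_trans ?_ hf
      gcongr
      rw [haV]; linarith
    have : a ^ p * ξ ^ p / Λ = a ^ (p - 1) / Λ * (a * ξ ^ p) := by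
      rw [Real.rpow_sub_one ha1.ne']; field_simp
    rw [this, zero_mul, sub_zero]
    gcongr
  · intro h0
    subst h0
    rw [Real.zero_rpow hp0.ne']
    rcases le_or_gt U k with hk | hk
    · rw [hbz hk]; simp
    have : f ≤ Λ * a ^ (p - 1) := by
      refine hf'.trans ?_
      gcongr
      rw [htab hk]; linarith
    have h2 : f * (b * ζ ^ p) ≤ Λ * a ^ (p - 1) * (b * ζ ^ p) := by gcongr
    linarith

lemma PhiBounds.bounds_of_nonneg {Λ p : ℝ} {Φ : ℝ → ℝ} (hΦ : PhiBounds Λ p Φ)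
    (hp : 1 < p) {t : ℝ} (ht : 0 ≤ t) :
    t ^ (p - 1) / Λ ≤ Φ t ∧ Φ t ≤ Λ * t ^ (p - 1) := by
  rcases eq_or_lt_of_le ht with h | h
  · rw [← h, hΦ.2.1, Real.zero_rpow (by linarith)]; simp
  · obtain ⟨h1, h2⟩ := hΦ.2.2 t
    rw [abs_of_nonneg ht] at h1 h2
    rw [Real.rpow_sub_one h.ne']
    constructor
    · rw [show t ^ p / t / Λ = t ^ p / Λ / t by ring, div_le_iff₀ h]; exact h1
    · rw [show Λ * (t ^ p / t) = Λ * t ^ p / t by ring, le_div_iff₀ h]; exact h2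

lemma PhiBounds.neg {Λ p : ℝ} {Φ : ℝ → ℝ} (hΦ : PhiBounds Λ p Φ) :
    PhiBounds Λ p (fun t => -Φ (-t)) := by
  refine ⟨(hΦ.1.comp continuous_neg).neg, by simp [hΦ.2.1], fun t => ?_⟩
  have := hΦ.2.2 (-t)
  rw [abs_neg] at this
  constructor <;> nlinarith [this.1, this.2]

lemma PhiBounds.abs_le {Λ p : ℝ} {Φ : ℝ → ℝ} (hΦ : PhiBounds Λ p Φ) (hp : 1 < p)
    (hΛ : 1 ≤ Λ) (t : ℝ) : |Φ t| ≤ Λ * |t| ^ (p - 1) := by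
  rcases le_total 0 t with ht | ht
  · obtain ⟨h1, h2⟩ := hΦ.bounds_of_nonneg hp ht
    rw [abs_of_nonneg (le_trans (by positivity) h1), abs_of_nonneg ht]; exact h2
  · obtain ⟨h1, h2⟩ := hΦ.neg.bounds_of_nonneg hp (t := -t) (by linarith)
    simp only [neg_neg] at h1 h2
    have : 0 ≤ -Φ t := le_trans (div_nonneg (Real.rpow_nonneg (by linarith) _) (by linarith)) h1
    rw [abs_of_nonpos (by linarith), abs_of_nonpos ht]; exact h2

/-- Pointwise estimates of the energy density tested with `(v - k)₊ η^p`. -/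
lemma PhiBounds.pair_estimates {Λ p : ℝ} {Φ : ℝ → ℝ} (hΦ : PhiBounds Λ p Φ) (hp : 1 < p)
    (hΛ : 1 ≤ Λ) (k V U : ℝ) {ξ ζ : ℝ} (hξ : 0 ≤ ξ) (hζ : 0 ≤ ζ) :
    (-(Λ * p ^ p * (max (V - k) 0 ^ p + max (U - k) 0 ^ p) * |ξ - ζ| ^ p)
      ≤ Φ (V - U) * (max (V - k) 0 * ξ ^ p - max (U - k) 0 * ζ ^ p)) ∧
    (U ≤ k → max (V - k) 0 ^ p * ξ ^ p / Λ
      ≤ Φ (V - U) * (max (V - k) 0 * ξ ^ p - max (U - k) 0 * ζ ^ p)) ∧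
    (ξ = 0 → -(Λ * max (V - k) 0 ^ (p - 1) * (max (U - k) 0 * ζ ^ p))
      ≤ Φ (V - U) * (max (V - k) 0 * ξ ^ p - max (U - k) 0 * ζ ^ p)) ∧
    (ζ = 0 → -(Λ * max (U - k) 0 ^ (p - 1) * (max (V - k) 0 * ξ ^ p))
      ≤ Φ (V - U) * (max (V - k) 0 * ξ ^ p - max (U - k) 0 * ζ ^ p)) := by
  have hp0 : p ≠ 0 := by linarith
  have hΛ0 : 0 < Λ := by linarith
  have ha0 : 0 ≤ max (V - k) 0 := le_max_right _ _
  have hb0 : 0 ≤ max (U - k) 0 := le_max_right _ _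
  rcases le_total U V with h | h
  · obtain ⟨h1, h2⟩ := hΦ.bounds_of_nonneg hp (t := V - U) (by linarith)
    obtain ⟨e1, e2, e3⟩ := ordered_pair_estimates (k := k) hp hΛ h hξ hζ h1 h2
    refine ⟨e1, e2, e3, fun h0 => ?_⟩
    subst h0
    have hf0 : 0 ≤ Φ (V - U) := le_trans (by have : 0 ≤ V - U := by linarith
                                             positivity) h1
    rw [Real.zero_rpow hp0, mul_zero, sub_zero]
    have : 0 ≤ Λ * max (U - k) 0 ^ (p - 1) * (max (V - k) 0 * ξ ^ p) := by positivity
    have : 0 ≤ Φ (V - U) * (max (V - k) 0 * ξ ^ p) := by positivity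
    linarith
  · obtain ⟨h1, h2⟩ := hΦ.neg.bounds_of_nonneg hp (t := U - V) (by linarith)
    simp only [neg_sub] at h1 h2
    obtain ⟨e1, e2, e3⟩ := ordered_pair_estimates (k := k) hp hΛ h hζ hξ h1 h2
    have hs : -Φ (V - U) * (max (U - k) 0 * ζ ^ p - max (V - k) 0 * ξ ^ p)
      = Φ (V - U) * (max (V - k) 0 * ξ ^ p - max (U - k) 0 * ζ ^ p) := by ring
    rw [hs, abs_sub_comm, add_comm (max (U - k) 0 ^ p)] at e1
    rw [hs] at e3
    refine ⟨e1, fun hU => ?_, fun h0 => ?_, e3⟩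
    · rw [max_eq_right (by linarith : V - k ≤ 0), max_eq_right (by linarith : U - k ≤ 0)]
      simp [Real.zero_rpow hp0]
    · subst h0
      have hf0 : 0 ≤ -Φ (V - U) := le_trans (by have : 0 ≤ U - V := by linarith
                                                positivity) h1
      rw [Real.zero_rpow hp0, mul_zero, zero_sub]
      have : 0 ≤ Λ * max (V - k) 0 ^ (p - 1) * (max (U - k) 0 * ζ ^ p) := by positivity
      have : 0 ≤ (-Φ (V - U)) * (max (U - k) 0 * ζ ^ p) := by positivity
      linarith

/-! ### Admissibility of nonsmooth test functions -/

/-- The diagonal translation of `ℝⁿ × ℝⁿ`. -/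
def diagShift (n : ℕ) (z : Rn n) (w : Rn n × Rn n) : Rn n × Rn n := (w.1 - z, w.2 - z)

lemma measurePreserving_diagShift (n : ℕ) (z : Rn n) :
    MeasurePreserving (diagShift n z) (volume.prod volume) (volume.prod volume) :=
  (measurePreserving_sub_right volume z).prod (measurePreserving_sub_right volume z)

lemma continuous_integral_mul_diagShift {n : ℕ} {p q : ℝ≥0∞} [hpq : ENNReal.HolderConjugate p q]
    (hq : q ≠ ∞) {F G : Rn n × Rn n → ℝ} (hF : MemLp F p (volume.prod volume))
    (hG : MemLp G q (volume.prod volume)) :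
    Continuous fun z : Rn n => ∫ w, F w * G (diagShift n z w) ∂(volume.prod volume) := by
  have : Fact (1 ≤ p) := ⟨ENNReal.HolderConjugate.one_le p q⟩
  have : Fact (1 ≤ q) := ⟨ENNReal.HolderConjugate.one_le q p⟩
  let T : C(Rn n, C(Rn n × Rn n, Rn n × Rn n)) :=
    (ContinuousMap.mk (fun a : Rn n × (Rn n × Rn n) => diagShift n a.1 a.2)
      (by unfold diagShift; fun_prop)).curry
  have hT : ∀ z, MeasurePreserving (T z) (volume.prod volume) (volume.prod volume) :=
    measurePreserving_diagShift n
  have hc : Continuous fun z => Lp.compMeasurePreserving (T z) (hT z) (hG.toLp G) :=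
    Continuous.compMeasurePreservingLp continuous_const T.continuous hT hq
  have hc2 := ((ContinuousLinearMap.mul ℝ ℝ).lpPairing (volume.prod volume) p q
    (hF.toLp F)).continuous.comp hc
  refine hc2.congr fun z => ?_
  simp only [Function.comp]
  rw [ContinuousLinearMap.lpPairing_eq_integral]
  refine integral_congr_ae ?_
  have h1 := Lp.coeFn_compMeasurePreserving (hG.toLp G) (hT z)
  have h2 := (hT z).quasiMeasurePreserving.ae_eq_comp hG.coeFn_toLp
  filter_upwards [h1, h2, hF.coeFn_toLp] with w e1 e2 e3
  rw [e1, e2, e3]; rfl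

/-- The weighted increment `(u(x) - u(y)) / |x - y|^{n/p + s}`. -/
def incr (n : ℕ) (s p : ℝ) (u : Rn n → ℝ) (w : Rn n × Rn n) : ℝ :=
  (u w.1 - u w.2) / ‖w.1 - w.2‖ ^ (((n : ℝ) + s * p) / p)

/-- The nonlocal flux, weighted so as to be dual to `incr`. -/
def flux (n : ℕ) (s p : ℝ) (Φ : ℝ → ℝ) (K : Rn n → Rn n → ℝ) (v : Rn n → ℝ)
    (w : Rn n × Rn n) : ℝ :=
  Φ (v w.1 - v w.2) * K w.1 w.2 * ‖w.1 - w.2‖ ^ (((n : ℝ) + s * p) / p)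

lemma measurable_incr {n : ℕ} {s p : ℝ} {u : Rn n → ℝ} (hu : Measurable u) :
    Measurable (incr n s p u) := by
  unfold incr
  exact ((hu.comp measurable_fst).sub (hu.comp measurable_snd)).div
    ((measurable_fst.sub measurable_snd).norm.pow_const _)

lemma measurable_flux {n : ℕ} {s p Λ : ℝ} {Φ : ℝ → ℝ} {K : Rn n → Rn n → ℝ} {v : Rn n → ℝ}
    (hΦ : PhiBounds Λ p Φ) (hK : KernelBounds n Λ s p K) (hv : Measurable v) :
    Measurable (flux n s p Φ K v) := by
  unfold flux
  exact ((hΦ.1.measurable.comp ((hv.comp measurable_fst).sub (hv.comp measurable_snd))).mul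
    hK.1).mul ((measurable_fst.sub measurable_snd).norm.pow_const _)

lemma incr_diagShift {n : ℕ} {s p : ℝ} {u : Rn n → ℝ} (z : Rn n) (w : Rn n × Rn n) :
    incr n s p u (diagShift n z w)
      = (u (w.1 - z) - u (w.2 - z)) / ‖w.1 - w.2‖ ^ (((n : ℝ) + s * p) / p) := by
  simp [incr, diagShift]

lemma flux_mul {n : ℕ} {s p Λ : ℝ} {Φ : ℝ → ℝ} {K : Rn n → Rn n → ℝ} {v : Rn n → ℝ}
    (hΦ : PhiBounds Λ p Φ) (w : Rn n × Rn n) (t : ℝ) :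
    flux n s p Φ K v w * (t / ‖w.1 - w.2‖ ^ (((n : ℝ) + s * p) / p))
      = Φ (v w.1 - v w.2) * t * K w.1 w.2 := by
  rcases eq_or_ne w.1 w.2 with h | h
  · simp [flux, h, hΦ.2.1]
  · have h0 : 0 < ‖w.1 - w.2‖ := norm_pos_iff.2 (sub_ne_zero.2 h)
    have : ‖w.1 - w.2‖ ^ (((n : ℝ) + s * p) / p) ≠ 0 := (Real.rpow_pos_of_pos h0 _).ne'
    unfold flux
    field_simp

lemma memLp_incr {n : ℕ} {s p : ℝ} (hp : 1 < p) {u : Rn n → ℝ} (hu : Measurable u)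
    (hg : gagliardo n s p univ u < ⊤) :
    MemLp (incr n s p u) (ENNReal.ofReal p) (volume.prod volume) := by
  have hp0 : 0 < p := by linarith
  refine ⟨(measurable_incr hu).aestronglyMeasurable, ?_⟩
  rw [eLpNorm_lt_top_iff_lintegral_rpow_enorm_lt_top (by simpa using hp0) ENNReal.ofReal_ne_top,
    ENNReal.toReal_ofReal hp0.le,
    lintegral_prod _ ((measurable_incr hu).enorm.pow_const p).aemeasurable]
  unfold gagliardo at hg
  simp only [Measure.restrict_univ] at hg
  refine lt_of_eq_of_lt ?_ hg
  refine lintegral_congr fun x => lintegral_congr fun y => ?_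
  rw [← ofReal_norm, ENNReal.ofReal_rpow_of_nonneg (norm_nonneg _) hp0.le]
  congr 1
  unfold incr
  rw [norm_div, Real.norm_eq_abs, Real.norm_of_nonneg (Real.rpow_nonneg (norm_nonneg _) _),
    Real.div_rpow (abs_nonneg _) (Real.rpow_nonneg (norm_nonneg _) _),
    ← Real.rpow_mul (norm_nonneg _), div_mul_cancel₀ _ hp0.ne']

lemma memLp_flux {n : ℕ} {s p Λ : ℝ} (hp : 1 < p) (hΛ : 1 ≤ Λ) {Φ : ℝ → ℝ}
    {K : Rn n → Rn n → ℝ} {v : Rn n → ℝ}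
    (hΦ : PhiBounds Λ p Φ) (hK : KernelBounds n Λ s p K) (hv : Measurable v)
    (hg : gagliardo n s p univ v < ⊤) :
    MemLp (flux n s p Φ K v) (ENNReal.ofReal (p / (p - 1))) (volume.prod volume) := by
  have hp0 : 0 < p := by linarith
  have hp1 : 0 < p - 1 := by linarith
  have h := (memLp_incr hp hv hg).norm_rpow_div (ENNReal.ofReal (p - 1))
  rw [ENNReal.toReal_ofReal hp1.le, ← ENNReal.ofReal_div_of_pos hp1] at h
  refine h.of_le_mul (c := Λ * Λ) (measurable_flux hΦ hK hv).aestronglyMeasurable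
    (Eventually.of_forall fun w => ?_)
  rcases eq_or_ne w.1 w.2 with hw | hw
  · simp only [flux, hw, sub_self, hΦ.2.1, zero_mul, norm_zero]
    positivity
  have h0 : 0 < ‖w.1 - w.2‖ := norm_pos_iff.2 (sub_ne_zero.2 hw)
  obtain ⟨k1, k2⟩ := hK.2 w.1 w.2 hw
  have hKabs : |K w.1 w.2| ≤ Λ / ‖w.1 - w.2‖ ^ ((n : ℝ) + s * p) := by
    rw [abs_of_nonneg (le_trans (by positivity) k1)]; exact k2
  have hΦabs := hΦ.abs_le hp hΛ (v w.1 - v w.2)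
  rw [Real.norm_of_nonneg (Real.rpow_nonneg (norm_nonneg (incr n s p v w)) _)]
  unfold flux incr
  simp only [norm_mul, norm_div, Real.norm_eq_abs]
  rw [abs_of_nonneg (Real.rpow_nonneg (norm_nonneg _) _),
    Real.div_rpow (abs_nonneg _) (Real.rpow_nonneg (norm_nonneg _) _),
    ← Real.rpow_mul (norm_nonneg _)]
  set d := (n : ℝ) + s * p
  set ρ := ‖w.1 - w.2‖
  have e : ρ ^ d = ρ ^ (d / p * (p - 1)) * ρ ^ (d / p) := by
    rw [← Real.rpow_add h0]; congr 1; field_simp; ring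
  have hA : 0 < ρ ^ (d / p * (p - 1)) := Real.rpow_pos_of_pos h0 _
  have hB : 0 < ρ ^ (d / p) := Real.rpow_pos_of_pos h0 _
  rw [e] at hKabs
  calc |Φ (v w.1 - v w.2)| * |K w.1 w.2| * ρ ^ (d / p)
      ≤ (Λ * |v w.1 - v w.2| ^ (p - 1)) * (Λ / (ρ ^ (d / p * (p - 1)) * ρ ^ (d / p)))
          * ρ ^ (d / p) := by gcongr
    _ = _ := by field_simp

lemma holderConjugate_conjExponent {p : ℝ} (hp : 1 < p) :
    ENNReal.HolderConjugate (ENNReal.ofReal (p / (p - 1))) (ENNReal.ofReal p) :=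
  (Real.HolderConjugate.conjExponent hp).symm.ennrealOfReal

lemma continuous_shifted_form {n : ℕ} {s p Λ : ℝ} (hp : 1 < p) (hΛ : 1 ≤ Λ) {Φ : ℝ → ℝ}
    {K : Rn n → Rn n → ℝ} {v φ : Rn n → ℝ}
    (hΦ : PhiBounds Λ p Φ) (hK : KernelBounds n Λ s p K) (hv : Measurable v)
    (hg : gagliardo n s p univ v < ⊤) (hφ : Measurable φ) (hgφ : gagliardo n s p univ φ < ⊤) :
    (Continuous fun z => ∫ w, flux n s p Φ K v w * incr n s p φ (diagShift n z w)
        ∂(volume.prod volume)) ∧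
    (Continuous fun z => ∫ w, ‖flux n s p Φ K v w * incr n s p φ (diagShift n z w)‖
        ∂(volume.prod volume)) ∧
    ∀ z, Integrable (fun w => flux n s p Φ K v w * incr n s p φ (diagShift n z w))
        (volume.prod volume) := by
  have hF := memLp_flux hp hΛ hΦ hK hv hg
  have hG := memLp_incr hp hφ hgφ
  have := holderConjugate_conjExponent hp
  refine ⟨continuous_integral_mul_diagShift ENNReal.ofReal_ne_top hF hG, ?_, fun z => ?_⟩
  · simp only [norm_mul]
    exact continuous_integral_mul_diagShift ENNReal.ofReal_ne_top hF.norm hG.norm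
  · exact hF.integrable_mul (hG.comp_measurePreserving (measurePreserving_diagShift n z))

lemma isTestFun_convolution {n : ℕ} {Ω : Set (Rn n)} {φ g : Rn n → ℝ} {x₀ : Rn n} {ρ ρ' : ℝ}
    (hφ : Integrable φ) (hsupp : ∀ x, x ∉ ball x₀ ρ → φ x = 0) (hΩ : ball x₀ ρ' ⊆ Ω)
    (hg : ContDiff ℝ (⊤ : ℕ∞) g) (hgc : HasCompactSupport g) {ε : ℝ} (hε : ρ + ε < ρ')
    (hgs : tsupport g ⊆ ball 0 ε) :
    IsTestFun n Ω (fun x => ∫ z, g z * φ (x - z)) := by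
  have heq : (fun x => ∫ z, g z * φ (x - z))
      = convolution g φ (ContinuousLinearMap.mul ℝ ℝ) volume := by
    ext x; simp [convolution]
  have hsub : Function.support (fun x => ∫ z, g z * φ (x - z)) ⊆ closedBall x₀ (ρ + ε) := by
    rw [heq]
    refine (support_convolution_subset _).trans ?_
    rintro _ ⟨a, ha, b, hb, rfl⟩
    have h1 := hgs (subset_tsupport g ha)
    have h2 : b ∈ ball x₀ ρ := by
      by_contra h; exact hb (hsupp b h)
    rw [mem_ball, dist_zero_right] at h1
    rw [mem_ball, dist_eq_norm] at h2
    simp only [mem_closedBall, dist_eq_norm]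
    calc ‖a + b - x₀‖ = ‖(b - x₀) + a‖ := by congr 1; abel
      _ ≤ ‖b - x₀‖ + ‖a‖ := norm_add_le _ _
      _ ≤ _ := by linarith
  have hts : tsupport (fun x => ∫ z, g z * φ (x - z)) ⊆ closedBall x₀ (ρ + ε) :=
    closure_minimal hsub isClosed_closedBall
  refine ⟨?_, ?_, hts.trans ((closedBall_subset_ball hε).trans hΩ)⟩
  · rw [heq]
    exact hgc.contDiff_convolution_left _ hg hφ.locallyIntegrable
  · exact (isCompact_closedBall x₀ (ρ + ε)).of_isClosed_subset (isClosed_tsupport _) hts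

/-- Weak solutions can be tested with compactly supported functions of finite energy. -/
lemma integral_form_eq_zero {n : ℕ} {s p Λ : ℝ} (hp : 1 < p) (hΛ : 1 ≤ Λ) {Φ : ℝ → ℝ}
    {K : Rn n → Rn n → ℝ} {v φ : Rn n → ℝ} {Ω : Set (Rn n)} {x₀ : Rn n} {ρ ρ' : ℝ}
    (hΦ : PhiBounds Λ p Φ) (hK : KernelBounds n Λ s p K) (hv : Measurable v)
    (hg : gagliardo n s p univ v < ⊤)
    (hsol : ∀ φ : Rn n → ℝ, IsTestFun n Ω φ → nonlocalForm n Φ K v φ = 0)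
    (hφ : Measurable φ) (hφi : Integrable φ) (hgφ : gagliardo n s p univ φ < ⊤)
    (hsupp : ∀ x, x ∉ ball x₀ ρ → φ x = 0) (hρ : ρ < ρ') (hΩ : ball x₀ ρ' ⊆ Ω) :
    Integrable (fun w : Rn n × Rn n => Φ (v w.1 - v w.2) * (φ w.1 - φ w.2) * K w.1 w.2)
      (volume.prod volume) ∧
    ∫ w : Rn n × Rn n, Φ (v w.1 - v w.2) * (φ w.1 - φ w.2) * K w.1 w.2
      ∂(volume.prod volume) = 0 := by
  obtain ⟨hc1, hc2, h_int⟩ := continuous_shifted_form hp hΛ hΦ hK hv hg hφ hgφ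
  set h : Rn n → ℝ := fun z => ∫ w, flux n s p Φ K v w * incr n s p φ (diagShift n z w)
        ∂(volume.prod volume) with hh
  have hid : ∀ (z : Rn n) (w : Rn n × Rn n), flux n s p Φ K v w * incr n s p φ (diagShift n z w)
      = Φ (v w.1 - v w.2) * (φ (w.1 - z) - φ (w.2 - z)) * K w.1 w.2 := fun z w => by
    rw [incr_diagShift, flux_mul hΦ]
  have hid0 : (fun w => flux n s p Φ K v w * incr n s p φ (diagShift n 0 w))
      = fun w : Rn n × Rn n => Φ (v w.1 - v w.2) * (φ w.1 - φ w.2) * K w.1 w.2 := by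
    ext w; rw [hid]; simp
  have h0i := h_int 0
  rw [hid0] at h0i
  refine ⟨h0i, ?_⟩
  have hzero : ∀ g : Rn n → ℝ, ContDiff ℝ (⊤ : ℕ∞) g → HasCompactSupport g →
      tsupport g ⊆ ball 0 ((ρ' - ρ) / 2) → ∫ z, g z • h z = 0 := by
    intro g hgs hgc hgt
    have htest := isTestFun_convolution hφi hsupp hΩ hgs hgc
      (ε := (ρ' - ρ) / 2) (by linarith) hgt
    have hform := hsol _ htest
    have hmeas : Measurable fun q : (Rn n × Rn n) × Rn n =>
        g q.2 * (flux n s p Φ K v q.1 * incr n s p φ (diagShift n q.2 q.1)) := by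
      refine (hgs.continuous.measurable.comp measurable_snd).mul
        (((measurable_flux hΦ hK hv).comp measurable_fst).mul
          ((measurable_incr hφ).comp ?_))
      unfold diagShift
      exact (by fun_prop : Continuous fun q : (Rn n × Rn n) × Rn n =>
        (q.1.1 - q.2, q.1.2 - q.2)).measurable
    have htriple : Integrable (fun q : (Rn n × Rn n) × Rn n =>
        g q.2 * (flux n s p Φ K v q.1 * incr n s p φ (diagShift n q.2 q.1)))
        ((volume.prod volume).prod volume) := by
      rw [integrable_prod_iff' hmeas.aestronglyMeasurable]
      refine ⟨Eventually.of_forall fun z => (h_int z).const_mul (g z), ?_⟩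
      simp only [norm_mul (g _), integral_const_mul]
      exact (hgs.continuous.norm.mul hc2).integrable_of_hasCompactSupport hgc.norm.mul_right
    have hgφi : ∀ x, Integrable (fun z => g z * φ (x - z)) := fun x => by
      obtain ⟨C, hC⟩ := hgc.exists_bound_of_continuous hgs.continuous
      exact (hφi.comp_sub_left x).bdd_mul hgs.continuous.aestronglyMeasurable
        (Eventually.of_forall hC)
    have hpt : ∀ w : Rn n × Rn n,
        ∫ z, g z * (flux n s p Φ K v w * incr n s p φ (diagShift n z w))
        = Φ (v w.1 - v w.2) * ((∫ z, g z * φ (w.1 - z)) - ∫ z, g z * φ (w.2 - z)) * K w.1 w.2 := by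
      intro w
      rw [← integral_sub (hgφi _) (hgφi _), ← integral_const_mul, ← integral_mul_const]
      refine integral_congr_ae (Eventually.of_forall fun z => ?_)
      simp only [hid]; ring
    have h1 : ∫ z, g z • h z
        = ∫ q : (Rn n × Rn n) × Rn n,
          g q.2 * (flux n s p Φ K v q.1 * incr n s p φ (diagShift n q.2 q.1))
          ∂((volume.prod volume).prod volume) := by
      rw [integral_prod_symm _ htriple]
      simp only [hh, smul_eq_mul, integral_const_mul]
    rw [h1, integral_prod _ htriple]
    have hleft := htriple.integral_prod_left
    simp only [hpt] at hleft ⊢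
    rw [integral_prod _ hleft]
    exact hform
  have hae := isOpen_ball.ae_eq_zero_of_integral_contDiff_smul_eq_zero
    (hc1.locallyIntegrable.locallyIntegrableOn _) hzero
  have hlast : h 0 = 0 := by
    have hε : (0 : ℝ) < (ρ' - ρ) / 2 := by linarith
    have := Measure.eqOn_open_of_ae_eq (μ := volume) (f := h) (g := fun _ => 0)
      (U := ball (0 : Rn n) ((ρ' - ρ) / 2))
      ((ae_restrict_iff' measurableSet_ball).2 hae) isOpen_ball hc1.continuousOn
      continuousOn_const
    exact this (mem_ball_self hε)
  rw [← hlast, hh]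
  simp only [hid]
  simp

/-! ### Kernel integrals -/

lemma integrable_truncated_kernel {n : ℕ} {s p : ℝ} (hn : 2 ≤ n) (hs : 0 < s) (hs1 : s < 1)
    (hp : 1 < p) :
    Integrable fun z : Rn n => min 1 ‖z‖ ^ p / ‖z‖ ^ ((n : ℝ) + s * p) := by
  have : Nontrivial (Rn n) := by
    have : Nonempty (Fin n) := ⟨⟨0, by lia⟩⟩
    infer_instance
  have hsp : 0 < s * p := by positivity
  rw [integrable_fun_norm_addHaar volume
    (f := fun t : ℝ => min 1 t ^ p / t ^ ((n : ℝ) + s * p))]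
  simp only [finrank_euclideanSpace, Fintype.card_fin, smul_eq_mul]
  rw [← Ioc_union_Ioi_eq_Ioi (zero_le_one (α := ℝ))]
  have hcast : ∀ t : ℝ, 0 < t → t ^ (n - 1) = t ^ ((n : ℝ) - 1) := fun t ht => by
    rw [← Real.rpow_natCast, Nat.cast_sub (by lia)]; simp
  refine IntegrableOn.union ?_ ?_
  · have h := (intervalIntegral.intervalIntegrable_rpow' (a := 0) (b := 1)
      (r := p - s * p - 1) (by nlinarith)).1
    refine h.congr_fun (fun t ht => ?_) measurableSet_Ioc
    simp only
    rw [hcast t ht.1, min_eq_right ht.2, ← Real.rpow_sub ht.1, ← Real.rpow_add ht.1]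
    congr 1; ring
  · have h := integrableOn_Ioi_rpow_of_lt (a := -1 - s * p) (by linarith) (zero_lt_one)
    refine h.congr_fun (fun t ht => ?_) measurableSet_Ioi
    have ht0 : (0 : ℝ) < t := lt_trans zero_lt_one ht
    simp only
    rw [hcast t ht0, min_eq_left (le_of_lt ht), Real.one_rpow, one_div, ← Real.rpow_neg ht0.le,
      ← Real.rpow_add ht0]
    congr 1; ring

lemma exists_truncated_kernel_bound {n : ℕ} {s p : ℝ} (hn : 2 ≤ n) (hs : 0 < s) (hs1 : s < 1)
    (hp : 1 < p) :
    ∃ C : ℝ, 0 < C ∧ ∀ L : ℝ, 0 < L → ∀ x : Rn n,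
      ∫⁻ y : Rn n, ENNReal.ofReal (min 1 (L * ‖x - y‖) ^ p / ‖x - y‖ ^ ((n : ℝ) + s * p))
        ≤ ENNReal.ofReal (C * L ^ (s * p)) := by
  have h_int := integrable_truncated_kernel hn hs hs1 hp
  set f : Rn n → ℝ := fun z => min 1 ‖z‖ ^ p / ‖z‖ ^ ((n : ℝ) + s * p) with hf
  have hfnn : ∀ z, 0 ≤ f z := fun z => by simp only [hf]; positivity
  refine ⟨(∫ z, f z) + 1, by
    have : 0 ≤ ∫ z, f z := integral_nonneg fun z => hfnn z
    linarith,
    fun L hL x => ?_⟩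
  have hscale : ∀ z : Rn n, min 1 (L * ‖z‖) ^ p / ‖z‖ ^ ((n : ℝ) + s * p)
      = L ^ ((n : ℝ) + s * p) * f (L • z) := fun z => by
    simp only [hf, norm_smul, Real.norm_of_nonneg hL.le]
    rw [Real.mul_rpow hL.le (norm_nonneg _)]
    have : L ^ ((n : ℝ) + s * p) ≠ 0 := (Real.rpow_pos_of_pos hL _).ne'
    field_simp
  rw [lintegral_sub_left_eq_self (μ := volume)
    (fun z : Rn n => ENNReal.ofReal (min 1 (L * ‖z‖) ^ p / ‖z‖ ^ ((n : ℝ) + s * p))) x]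
  simp only [hscale]
  have hi : Integrable fun z : Rn n => L ^ ((n : ℝ) + s * p) * f (L • z) :=
    (h_int.comp_smul hL.ne').const_mul _
  rw [← ofReal_integral_eq_lintegral_ofReal hi
    (Eventually.of_forall fun z => mul_nonneg (Real.rpow_nonneg hL.le _) (hfnn _))]
  refine ENNReal.ofReal_le_ofReal ?_
  rw [integral_const_mul, Measure.integral_comp_smul]
  simp only [finrank_euclideanSpace, Fintype.card_fin, smul_eq_mul]
  rw [abs_of_nonneg (by positivity), ← Real.rpow_natCast, Real.rpow_add hL]
  have : L ^ (n : ℝ) ≠ 0 := (Real.rpow_pos_of_pos hL _).ne'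
  have h2 : 0 < L ^ (s * p) := Real.rpow_pos_of_pos hL _
  calc L ^ (n : ℝ) * L ^ (s * p) * ((L ^ (n : ℝ))⁻¹ * ∫ z, f z)
      = (∫ z, f z) * L ^ (s * p) := by field_simp
    _ ≤ _ := by gcongr; linarith

lemma lintegral_kernel_compl_ge {n : ℕ} {s p : ℝ} (hn : 2 ≤ n) (hs : 0 < s) (hp : 1 < p)
    {τ : ℝ} (hτ : 0 < τ) {x : Rn n} {A B : Set (Rn n)} (hB : ball x τ ⊆ B)
    (hAB : 2 * volume A ≤ volume (ball (0 : Rn n) τ)) :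
    volume (ball (0 : Rn n) 1) / 2 * ENNReal.ofReal (τ ^ (-(s * p)))
      ≤ ∫⁻ y in B \ A, ENNReal.ofReal (1 / ‖x - y‖ ^ ((n : ℝ) + s * p)) := by
  have : Nontrivial (Rn n) := by
    have : Nonempty (Fin n) := ⟨⟨0, by lia⟩⟩
    infer_instance
  set d := (n : ℝ) + s * p with hd
  have hd0 : 0 < d := by positivity
  have hvol : volume (ball x τ) = ENNReal.ofReal (τ ^ n) * volume (ball (0 : Rn n) 1) := by
    rw [Measure.addHaar_ball _ _ hτ.le]; simp
  have hvol0 : volume (ball (0 : Rn n) τ) = volume (ball x τ) := by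
    rw [Measure.addHaar_ball _ _ hτ.le, Measure.addHaar_ball _ _ hτ.le]
  have hA : volume A ≤ volume (ball x τ) / 2 := by
    rw [ENNReal.le_div_iff_mul_le (by simp) (by simp), mul_comm, ← hvol0]; exact hAB
  have hfin : volume (ball x τ) / 2 ≠ ⊤ :=
    (ENNReal.div_lt_top measure_ball_lt_top.ne (by simp)).ne
  have hdiff : volume (ball x τ) / 2 ≤ volume (ball x τ \ A) := by
    have h1 : volume (ball x τ) ≤ volume (ball x τ \ A) + volume A := by
      refine (measure_mono (t := (ball x τ \ A) ∪ A) ?_).trans (measure_union_le _ _)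
      intro y hy; by_cases h : y ∈ A
      · exact Or.inr h
      · exact Or.inl ⟨hy, h⟩
    have h2 : volume (ball x τ) / 2 + volume (ball x τ) / 2
        ≤ volume (ball x τ \ A) + volume (ball x τ) / 2 := by
      rw [ENNReal.add_halves]; exact h1.trans (by gcongr)
    exact (ENNReal.add_le_add_iff_right hfin).1 h2
  have hne : ∀ᵐ y : Rn n, y ≠ x := by
    simp [ae_iff]
  calc volume (ball (0 : Rn n) 1) / 2 * ENNReal.ofReal (τ ^ (-(s * p)))
      = ENNReal.ofReal (1 / τ ^ d) * (volume (ball x τ) / 2) := by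
        rw [hvol]
        have : τ ^ (-(s * p)) = 1 / τ ^ d * τ ^ n := by
          rw [one_div, ← Real.rpow_neg hτ.le, ← Real.rpow_natCast, ← Real.rpow_add hτ]
          congr 1; rw [hd]; ring
        rw [this, ENNReal.ofReal_mul (by positivity), ENNReal.div_eq_inv_mul,
          ENNReal.div_eq_inv_mul]
        ring
    _ ≤ ENNReal.ofReal (1 / τ ^ d) * volume (ball x τ \ A) := by gcongr
    _ = ∫⁻ y in ball x τ \ A, ENNReal.ofReal (1 / τ ^ d) := by rw [setLIntegral_const]
    _ ≤ ∫⁻ y in ball x τ \ A, ENNReal.ofReal (1 / ‖x - y‖ ^ d) := by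
        refine setLIntegral_mono_ae (by fun_prop) ?_
        filter_upwards [hne] with y hy hyB
        have h1 : 0 < ‖x - y‖ := norm_pos_iff.2 (sub_ne_zero.2 (Ne.symm hy))
        have h2 : ‖x - y‖ ≤ τ := by
          have := mem_ball.1 hyB.1
          rw [dist_comm, dist_eq_norm] at this
          exact this.le
        exact ENNReal.ofReal_le_ofReal (one_div_le_one_div_of_le (Real.rpow_pos_of_pos h1 _)
          (Real.rpow_le_rpow h1.le h2 hd0.le))
    _ ≤ _ := lintegral_mono_set (sdiff_subset_sdiff_left hB)

/-! ### Cutoff functions and admissible test functions -/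

lemma lintegral_ofReal_le_of_le_add {α : Type*} [MeasurableSpace α] {μ : Measure α}
    {I g b : α → ℝ} (hI : Integrable I μ) (h0 : ∫ a, I a ∂μ = 0) (hb : Measurable b)
    (hb0 : ∀ a, 0 ≤ b a) (hg0 : ∀ a, 0 ≤ g a) (h : ∀ a, g a ≤ I a + b a) :
    ∫⁻ a, ENNReal.ofReal (g a) ∂μ ≤ ∫⁻ a, ENNReal.ofReal (b a) ∂μ := by
  by_cases htop : ∫⁻ a, ENNReal.ofReal (b a) ∂μ = ⊤
  · rw [htop]; exact le_top
  have hbi : Integrable b μ := by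
    refine ⟨hb.aestronglyMeasurable, ?_⟩
    rw [hasFiniteIntegral_iff_ofReal (Eventually.of_forall hb0)]
    exact lt_top_iff_ne_top.2 htop
  calc ∫⁻ a, ENNReal.ofReal (g a) ∂μ ≤ ∫⁻ a, ENNReal.ofReal (I a + b a) ∂μ :=
        lintegral_mono fun a => ENNReal.ofReal_le_ofReal (h a)
    _ = ENNReal.ofReal (∫ a, (I a + b a) ∂μ) :=
        (ofReal_integral_eq_lintegral_ofReal (hI.add hbi)
          (Eventually.of_forall fun a => (hg0 a).trans (h a))).symm
    _ = ENNReal.ofReal (∫ a, b a ∂μ) := by rw [integral_add hI hbi, h0, zero_add]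
    _ = _ := ofReal_integral_eq_lintegral_ofReal hbi (Eventually.of_forall hb0)

/-- The radial cutoff, equal to `1` on `B_{a - 1/L}(x₀)` and to `0` off `B_a(x₀)`. -/
def radialCutoff {n : ℕ} (x₀ : Rn n) (a L : ℝ) (x : Rn n) : ℝ :=
  min 1 (max 0 ((a - ‖x - x₀‖) * L))

section radialCutoff

variable {n : ℕ} {x₀ : Rn n} {a L : ℝ}

lemma measurable_radialCutoff : Measurable (radialCutoff x₀ a L) := by
  unfold radialCutoff
  fun_prop

lemma radialCutoff_nonneg (x : Rn n) : 0 ≤ radialCutoff x₀ a L x :=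
  le_min zero_le_one (le_max_left _ _)

lemma radialCutoff_le_one (x : Rn n) : radialCutoff x₀ a L x ≤ 1 := min_le_left _ _

lemma radialCutoff_eq_zero (hL : 0 < L) {x : Rn n} (hx : x ∉ ball x₀ a) :
    radialCutoff x₀ a L x = 0 := by
  have : a ≤ ‖x - x₀‖ := by rw [← dist_eq_norm]; simpa using hx
  unfold radialCutoff
  rw [max_eq_left (mul_nonpos_of_nonpos_of_nonneg (by linarith) hL.le),
    min_eq_right zero_le_one]

lemma radialCutoff_eq_one (hL : 0 < L) {x : Rn n} {b : ℝ} (hb : b + 1 / L ≤ a)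
    (hx : x ∈ ball x₀ b) : radialCutoff x₀ a L x = 1 := by
  have h1 : ‖x - x₀‖ < b := by rw [← dist_eq_norm]; simpa using hx
  have h2 : 1 ≤ (a - ‖x - x₀‖) * L := by
    rw [← div_le_iff₀ hL]; linarith
  exact min_eq_left (h2.trans (le_max_right _ _))

lemma abs_radialCutoff_sub_le (hL : 0 < L) (x y : Rn n) :
    |radialCutoff x₀ a L x - radialCutoff x₀ a L y| ≤ min 1 (L * ‖x - y‖) := by
  refine le_min ?_ ?_
  · rw [abs_le]
    have := radialCutoff_nonneg (x₀ := x₀) (a := a) (L := L) x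
    have := radialCutoff_nonneg (x₀ := x₀) (a := a) (L := L) y
    have := radialCutoff_le_one (x₀ := x₀) (a := a) (L := L) x
    have := radialCutoff_le_one (x₀ := x₀) (a := a) (L := L) y
    constructor <;> linarith
  · unfold radialCutoff
    refine (abs_min_sub_min_le_max _ _ _ _).trans ?_
    rw [sub_self, abs_zero, max_eq_right (abs_nonneg _)]
    refine (abs_max_sub_max_le_max _ _ _ _).trans ?_
    rw [sub_self, abs_zero, max_eq_right (abs_nonneg _), ← sub_mul, abs_mul, abs_of_pos hL,
      mul_comm]
    gcongr
    have h := abs_norm_sub_norm_le (x - x₀) (y - x₀)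
    rw [sub_sub_sub_cancel_right] at h
    rwa [abs_sub_comm, show a - ‖y - x₀‖ - (a - ‖x - x₀‖) = ‖x - x₀‖ - ‖y - x₀‖ by ring]

end radialCutoff

lemma add_rpow_le_two_rpow_mul {p a b : ℝ} (hp : 1 ≤ p) (ha : 0 ≤ a) (hb : 0 ≤ b) :
    (a + b) ^ p ≤ 2 ^ (p - 1) * (a ^ p + b ^ p) := by
  lift a to ℝ≥0 using ha
  lift b to ℝ≥0 using hb
  exact_mod_cast NNReal.rpow_add_le_mul_rpow_add_rpow a b hp

lemma max_sub_zero_le_abs {k : ℝ} (hk : 0 ≤ k) (t : ℝ) : max (t - k) 0 ≤ |t| :=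
  max_le (by linarith [le_abs_self t]) (abs_nonneg t)

lemma integrable_truncation_mul_cutoff {n : ℕ} {p k a L : ℝ} (hp : 1 < p) (hk : 0 ≤ k)
    (hL : 0 < L) {v : Rn n → ℝ} (hv : Measurable v)
    (hvp : ∫⁻ x, ENNReal.ofReal (|v x| ^ p) < ⊤) (x₀ : Rn n) :
    Integrable fun x => max (v x - k) 0 * radialCutoff x₀ a L x ^ p := by
  have hm : Measurable (radialCutoff x₀ a L) := measurable_radialCutoff
  have h1 : Integrable fun x => |v x| ^ p := by
    refine ⟨(by fun_prop : Measurable fun x => |v x| ^ p).aestronglyMeasurable, ?_⟩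
    rwa [hasFiniteIntegral_iff_ofReal (Eventually.of_forall fun x => by positivity)]
  have h2 : Integrable ((ball x₀ a).indicator fun _ => (1 : ℝ)) :=
    (integrable_indicator_iff measurableSet_ball).2
      (integrableOn_const measure_ball_lt_top.ne)
  refine (h2.add h1).mono' (by fun_prop) (Eventually.of_forall fun x => ?_)
  have hη0 : 0 ≤ radialCutoff x₀ a L x := radialCutoff_nonneg x
  have hw0 : 0 ≤ max (v x - k) 0 := le_max_right _ _
  rw [Real.norm_of_nonneg (by positivity), Pi.add_apply]
  by_cases hx : x ∈ ball x₀ a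
  · rw [indicator_of_mem hx]
    have h3 : radialCutoff x₀ a L x ^ p ≤ 1 :=
      Real.rpow_le_one hη0 (radialCutoff_le_one x) (by linarith)
    have h4 : |v x| ≤ 1 + |v x| ^ p := by
      rcases le_total |v x| 1 with h | h
      · have : 0 ≤ |v x| ^ p := by positivity
        linarith
      · have := Real.self_le_rpow_of_one_le h hp.le
        linarith
    calc max (v x - k) 0 * radialCutoff x₀ a L x ^ p ≤ max (v x - k) 0 * 1 := by gcongr
      _ ≤ |v x| := by rw [mul_one]; exact max_sub_zero_le_abs hk _
      _ ≤ _ := h4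
  · rw [indicator_of_notMem hx, radialCutoff_eq_zero hL hx, Real.zero_rpow (by linarith)]
    simp only [mul_zero, zero_add]
    positivity

lemma gagliardo_truncation_mul_cutoff_lt_top {n : ℕ} {s p k a L : ℝ} (hn : 2 ≤ n) (hs : 0 < s)
    (hs1 : s < 1) (hp : 1 < p) (hk : 0 ≤ k) (hL : 0 < L) {v : Rn n → ℝ} (hv : Measurable v)
    (hvp : ∫⁻ x, ENNReal.ofReal (|v x| ^ p) < ⊤) (hg : gagliardo n s p univ v < ⊤)
    (x₀ : Rn n) :
    gagliardo n s p univ (fun x => max (v x - k) 0 * radialCutoff x₀ a L x ^ p) < ⊤ := by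
  obtain ⟨C, hC, hker⟩ := exists_truncated_kernel_bound hn hs hs1 hp
  unfold gagliardo at hg ⊢
  simp only [Measure.restrict_univ] at hg ⊢
  set D : Rn n → Rn n → ℝ := fun x y => ‖x - y‖ ^ ((n : ℝ) + s * p) with hD
  have hD0 : ∀ x y, 0 ≤ D x y := fun x y => by simp only [hD]; positivity
  set φ : Rn n → ℝ := fun x => max (v x - k) 0 * radialCutoff x₀ a L x ^ p with hφ
  have hpt : ∀ x y, |φ x - φ y| ^ p / D x y ≤ 2 ^ (p - 1) * (|v x - v y| ^ p / D x y)
      + 2 ^ (p - 1) * p ^ p * |v x| ^ p * (min 1 (L * ‖x - y‖) ^ p / D x y) := by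
    intro x y
    have h1 : |φ x - φ y| ≤ |v x - v y| + |v x| * (p * min 1 (L * ‖x - y‖)) := by
      have hηx := radialCutoff_nonneg (x₀ := x₀) (a := a) (L := L) x
      have hηy := radialCutoff_nonneg (x₀ := x₀) (a := a) (L := L) y
      have hηx1 := radialCutoff_le_one (x₀ := x₀) (a := a) (L := L) x
      have hηy1 := radialCutoff_le_one (x₀ := x₀) (a := a) (L := L) y
      have e : φ x - φ y = (max (v x - k) 0 - max (v y - k) 0) * radialCutoff x₀ a L y ^ p
          + max (v x - k) 0 * (radialCutoff x₀ a L x ^ p - radialCutoff x₀ a L y ^ p) := by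
        simp only [hφ]; ring
      have h2 : |max (v x - k) 0 - max (v y - k) 0| ≤ |v x - v y| := by
        refine (abs_max_sub_max_le_max _ _ _ _).trans ?_
        simp
      rw [e]
      refine (abs_add_le _ _).trans ?_
      rw [abs_mul, abs_mul, abs_of_nonneg (le_max_right (v x - k) 0),
        abs_of_nonneg (Real.rpow_nonneg hηy p)]
      refine add_le_add ?_ ?_
      · calc _ ≤ |v x - v y| * 1 := by
              gcongr
              exact Real.rpow_le_one hηy hηy1 (by linarith)
          _ = _ := mul_one _
      · gcongr
        · exact max_sub_zero_le_abs hk _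
        · exact (abs_rpow_sub_rpow_le hp.le hηx hηx1 hηy hηy1).trans (by
            gcongr; exact abs_radialCutoff_sub_le hL x y)
    have hm0 : 0 ≤ min 1 (L * ‖x - y‖) := by positivity
    have h3 : |φ x - φ y| ^ p ≤ 2 ^ (p - 1) * (|v x - v y| ^ p
        + (|v x| * (p * min 1 (L * ‖x - y‖))) ^ p) :=
      (Real.rpow_le_rpow (abs_nonneg _) h1 (by linarith)).trans
        (add_rpow_le_two_rpow_mul hp.le (abs_nonneg _) (by positivity))
    rw [Real.mul_rpow (abs_nonneg _) (by positivity), Real.mul_rpow (by linarith) hm0] at h3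
    calc |φ x - φ y| ^ p / D x y ≤ (2 ^ (p - 1) * (|v x - v y| ^ p
        + |v x| ^ p * (p ^ p * min 1 (L * ‖x - y‖) ^ p))) / D x y :=
          div_le_div_of_nonneg_right h3 (hD0 x y)
      _ = _ := by ring
  have hDm : Measurable (Function.uncurry D) := by
    simp only [hD, Function.uncurry_def]; fun_prop
  calc ∫⁻ x, ∫⁻ y, ENNReal.ofReal (|φ x - φ y| ^ p / D x y)
      ≤ ∫⁻ x, (ENNReal.ofReal (2 ^ (p - 1)) * (∫⁻ y, ENNReal.ofReal (|v x - v y| ^ p / D x y))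
        + ENNReal.ofReal (2 ^ (p - 1) * p ^ p) * ENNReal.ofReal (C * L ^ (s * p))
          * ENNReal.ofReal (|v x| ^ p)) := by
        refine lintegral_mono fun x => ?_
        calc ∫⁻ y, ENNReal.ofReal (|φ x - φ y| ^ p / D x y)
            ≤ ∫⁻ y, (ENNReal.ofReal (2 ^ (p - 1)) * ENNReal.ofReal (|v x - v y| ^ p / D x y)
              + ENNReal.ofReal (2 ^ (p - 1) * p ^ p * |v x| ^ p)
                * ENNReal.ofReal (min 1 (L * ‖x - y‖) ^ p / D x y)) := by
              refine lintegral_mono fun y => ?_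
              rw [← ENNReal.ofReal_mul (by positivity), ← ENNReal.ofReal_mul (by positivity),
                ← ENNReal.ofReal_add (mul_nonneg (by positivity)
                  (div_nonneg (by positivity) (hD0 x y))) (mul_nonneg (by positivity)
                  (div_nonneg (by positivity) (hD0 x y)))]
              exact ENNReal.ofReal_le_ofReal (hpt x y)
          _ = ENNReal.ofReal (2 ^ (p - 1)) * (∫⁻ y, ENNReal.ofReal (|v x - v y| ^ p / D x y))
              + ENNReal.ofReal (2 ^ (p - 1) * p ^ p * |v x| ^ p)
                * ∫⁻ y, ENNReal.ofReal (min 1 (L * ‖x - y‖) ^ p / D x y) := by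
              rw [lintegral_add_left (by simp only [hD]; fun_prop),
                lintegral_const_mul' _ _ ENNReal.ofReal_ne_top,
                lintegral_const_mul' _ _ ENNReal.ofReal_ne_top]
          _ ≤ ENNReal.ofReal (2 ^ (p - 1)) * (∫⁻ y, ENNReal.ofReal (|v x - v y| ^ p / D x y))
              + ENNReal.ofReal (2 ^ (p - 1) * p ^ p * |v x| ^ p)
                * ENNReal.ofReal (C * L ^ (s * p)) := by
              gcongr
              exact hker L hL x
          _ = _ := by
              rw [ENNReal.ofReal_mul (q := |v x| ^ p) (by positivity)]
              ring
    _ = ENNReal.ofReal (2 ^ (p - 1)) * (∫⁻ x, ∫⁻ y, ENNReal.ofReal (|v x - v y| ^ p / D x y))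
        + ENNReal.ofReal (2 ^ (p - 1) * p ^ p) * ENNReal.ofReal (C * L ^ (s * p))
          * ∫⁻ x, ENNReal.ofReal (|v x| ^ p) := by
        rw [lintegral_add_right _ (by fun_prop),
          lintegral_const_mul' _ _ ENNReal.ofReal_ne_top,
          lintegral_const_mul' _ _ (ENNReal.mul_ne_top ENNReal.ofReal_ne_top
            ENNReal.ofReal_ne_top)]
    _ < ⊤ := ENNReal.add_lt_top.2 ⟨ENNReal.mul_lt_top ENNReal.ofReal_lt_top hg,
        ENNReal.mul_lt_top (ENNReal.mul_lt_top ENNReal.ofReal_lt_top ENNReal.ofReal_lt_top) hvp⟩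

/-! ### Caccioppoli estimate -/

/-- The error density in the Caccioppoli estimate for `(v - k)₊` on `B_ρ(x₀)`. -/
def caccioppoliError (n : ℕ) (s p : ℝ) (v : Rn n → ℝ) (k : ℝ) (x₀ : Rn n) (ρ c L : ℝ)
    (x y : Rn n) : ℝ :=
  (ball x₀ ρ).indicator (fun x => max (v x - k) 0 ^ p) x
      * (min 1 (L * ‖x - y‖) ^ p / ‖x - y‖ ^ ((n : ℝ) + s * p))
    + c * (ball x₀ ρ).indicator (fun x => max (v x - k) 0) x
      * (ball x₀ ρ)ᶜ.indicator (fun y => |v y| ^ (p - 1) / ‖y - x₀‖ ^ ((n : ℝ) + s * p)) y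

lemma caccioppoliError_nonneg {n : ℕ} {s p : ℝ} {v : Rn n → ℝ} {k : ℝ} {x₀ : Rn n}
    {ρ c L : ℝ} (hc : 0 ≤ c) (hL : 0 ≤ L) (x y : Rn n) :
    0 ≤ caccioppoliError n s p v k x₀ ρ c L x y := by
  have h1 : 0 ≤ (ball x₀ ρ).indicator (fun x => max (v x - k) 0 ^ p) x :=
    indicator_nonneg (fun x _ => by positivity) x
  have h2 : 0 ≤ (ball x₀ ρ).indicator (fun x => max (v x - k) 0) x :=
    indicator_nonneg (fun x _ => le_max_right _ _) x
  have h3 : 0 ≤ (ball x₀ ρ)ᶜ.indicator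
      (fun y => |v y| ^ (p - 1) / ‖y - x₀‖ ^ ((n : ℝ) + s * p)) y :=
    indicator_nonneg (fun x _ => by positivity) y
  unfold caccioppoliError
  positivity

lemma measurable_caccioppoliError {n : ℕ} {s p : ℝ} {v : Rn n → ℝ} (hv : Measurable v) {k : ℝ}
    {x₀ : Rn n} {ρ c L : ℝ} :
    Measurable fun w : Rn n × Rn n => caccioppoliError n s p v k x₀ ρ c L w.1 w.2 := by
  have h1 : Measurable ((ball x₀ ρ).indicator (fun x => max (v x - k) 0 ^ p)) :=
    (by fun_prop : Measurable fun x => max (v x - k) 0 ^ p).indicator measurableSet_ball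
  have h2 : Measurable ((ball x₀ ρ).indicator (fun x => max (v x - k) 0)) :=
    (by fun_prop : Measurable fun x => max (v x - k) 0).indicator measurableSet_ball
  have h3 : Measurable ((ball x₀ ρ)ᶜ.indicator
      (fun y => |v y| ^ (p - 1) / ‖y - x₀‖ ^ ((n : ℝ) + s * p))) :=
    (by fun_prop : Measurable fun y => |v y| ^ (p - 1) / ‖y - x₀‖ ^ ((n : ℝ) + s * p)).indicator
      measurableSet_ball.compl
  unfold caccioppoliError
  have hfst : ∀ f : Rn n → ℝ, Measurable f → Measurable fun w : Rn n × Rn n => f w.1 :=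
    fun f hf => hf.comp measurable_fst
  have hsnd : ∀ f : Rn n → ℝ, Measurable f → Measurable fun w : Rn n × Rn n => f w.2 :=
    fun f hf => hf.comp measurable_snd
  have h1' := hfst _ h1
  have h2' := hfst _ h2
  have h3' := hsnd _ h3
  fun_prop

lemma le_mul_kernel {Λ κ D P G : ℝ} (hΛ : 1 ≤ Λ) (hD : 0 < D) (hκ : 1 / (Λ * D) ≤ κ)
    (hG : 0 ≤ G) (hP : G / Λ ≤ P) : G / D ≤ Λ ^ 2 * (P * κ) := by
  have hΛ0 : 0 < Λ := by linarith
  have h0 : 0 ≤ P := le_trans (by positivity) hP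
  calc G / D = Λ ^ 2 * (G / Λ * (1 / (Λ * D))) := by field_simp
    _ ≤ _ := by gcongr

lemma mul_kernel_add_nonneg {Λ κ D P Q : ℝ} (hΛ : 1 ≤ Λ) (hD : 0 < D)
    (hκ : 1 / (Λ * D) ≤ κ) (hκ' : κ ≤ Λ / D) (hQ : 0 ≤ Q) (hP : -Q ≤ P) :
    0 ≤ Λ ^ 2 * (P * κ) + Λ ^ 3 * (Q / D) := by
  have hΛ0 : 0 < Λ := by linarith
  have hκ0 : 0 ≤ κ := le_trans (by positivity) hκ
  have h1 : -Q * κ ≤ P * κ := by gcongr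
  have h2 : Q * κ ≤ Q * (Λ / D) := by gcongr
  have h3 : 0 ≤ P * κ + Q * (Λ / D) := by linarith
  calc 0 ≤ Λ ^ 2 * (P * κ + Q * (Λ / D)) := by positivity
    _ = _ := by ring

section pointwise

variable {n : ℕ} {s p Λ : ℝ} {Φ : ℝ → ℝ} {K : Rn n → Rn n → ℝ} {v η : Rn n → ℝ} {k : ℝ}
  {x₀ : Rn n} {ρ c L : ℝ}

lemma form_add_error_nonneg (hp : 1 < p) (hΛ : 1 ≤ Λ) (hΦ : PhiBounds Λ p Φ)
    (hK : KernelBounds n Λ s p K) (hk : 0 ≤ k) (hc : 0 ≤ c) (hL : 0 ≤ L)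
    (hη0 : ∀ x, 0 ≤ η x) (hη1 : ∀ x, η x ≤ 1) (hηs : ∀ x, x ∉ ball x₀ ρ → η x = 0)
    (hηL : ∀ x y, |η x - η y| ≤ min 1 (L * ‖x - y‖))
    (hfar : ∀ x y, η x ≠ 0 → y ∉ ball x₀ ρ →
      1 / ‖x - y‖ ^ ((n : ℝ) + s * p) ≤ c / ‖y - x₀‖ ^ ((n : ℝ) + s * p)) (x y : Rn n) :
    0 ≤ Λ ^ 2 * (Φ (v x - v y) * (max (v x - k) 0 * η x ^ p - max (v y - k) 0 * η y ^ p)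
        * K x y)
      + Λ ^ 4 * p ^ p * (caccioppoliError n s p v k x₀ ρ c L x y
        + caccioppoliError n s p v k x₀ ρ c L y x) := by
  have hΛ0 : 0 < Λ := by linarith
  have hp0 : p ≠ 0 := by linarith
  have hE1 := caccioppoliError_nonneg (n := n) (s := s) (p := p) (v := v) (k := k) (x₀ := x₀)
    (ρ := ρ) hc hL x y
  have hE2 := caccioppoliError_nonneg (n := n) (s := s) (p := p) (v := v) (k := k) (x₀ := x₀)
    (ρ := ρ) hc hL y x
  rcases eq_or_ne x y with rfl | hxy
  · simp only [sub_self, mul_zero, zero_mul, zero_add]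
    positivity
  set D := ‖x - y‖ ^ ((n : ℝ) + s * p) with hD
  have hD0 : 0 < D := Real.rpow_pos_of_pos (norm_pos_iff.2 (sub_ne_zero.2 hxy)) _
  have hD' : ‖y - x‖ ^ ((n : ℝ) + s * p) = D := by rw [norm_sub_rev]
  obtain ⟨hκ, hκ'⟩ := hK.2 x y hxy
  obtain ⟨e1, -, e3, e4⟩ := hΦ.pair_estimates hp hΛ k (v x) (v y) (hη0 x) (hη0 y)
  have hwx : 0 ≤ max (v x - k) 0 := le_max_right _ _
  have hwy : 0 ≤ max (v y - k) 0 := le_max_right _ _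
  have hpp : 1 ≤ p ^ p := Real.one_le_rpow hp.le (by linarith)
  have far : ∀ x y : Rn n, ‖x - y‖ ^ ((n : ℝ) + s * p) = D → x ∈ ball x₀ ρ → y ∉ ball x₀ ρ →
      Λ ^ 3 * (Λ * max (v y - k) 0 ^ (p - 1) * (max (v x - k) 0 * η x ^ p) / D)
        ≤ Λ ^ 4 * p ^ p * caccioppoliError n s p v k x₀ ρ c L x y := by
    intro x y hD hx hy
    have hE := caccioppoliError_nonneg (n := n) (s := s) (p := p) (v := v) (k := k) (x₀ := x₀)
      (ρ := ρ) hc hL x y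
    have hwx : 0 ≤ max (v x - k) 0 := le_max_right _ _
    have hwy : 0 ≤ max (v y - k) 0 := le_max_right _ _
    by_cases h0 : η x = 0
    · rw [h0, Real.zero_rpow hp0]
      simp only [mul_zero, zero_div]
      positivity
    have h1 := hfar x y h0 hy
    rw [hD] at h1
    have h2 : max (v y - k) 0 ^ (p - 1) ≤ |v y| ^ (p - 1) :=
      Real.rpow_le_rpow hwy (max_sub_zero_le_abs hk _) (by linarith)
    have h3 : η x ^ p ≤ 1 := Real.rpow_le_one (hη0 x) (hη1 x) (by linarith)
    have h4 : max (v y - k) 0 ^ (p - 1) * (max (v x - k) 0 * η x ^ p) / D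
        ≤ caccioppoliError n s p v k x₀ ρ c L x y := by
      have hηp : 0 ≤ η x ^ p := Real.rpow_nonneg (hη0 x) p
      unfold caccioppoliError
      rw [indicator_of_mem hx, indicator_of_mem hx,
        indicator_of_mem (show y ∈ (ball x₀ ρ)ᶜ from hy)]
      calc max (v y - k) 0 ^ (p - 1) * (max (v x - k) 0 * η x ^ p) / D
          = max (v y - k) 0 ^ (p - 1) * (max (v x - k) 0 * η x ^ p) * (1 / D) := by ring
        _ ≤ |v y| ^ (p - 1) * (max (v x - k) 0 * 1) * (c / ‖y - x₀‖ ^ ((n : ℝ) + s * p)) := by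
            gcongr
        _ = c * max (v x - k) 0 * (|v y| ^ (p - 1) / ‖y - x₀‖ ^ ((n : ℝ) + s * p)) := by ring
        _ ≤ _ := le_add_of_nonneg_left (by positivity)
    calc Λ ^ 3 * (Λ * max (v y - k) 0 ^ (p - 1) * (max (v x - k) 0 * η x ^ p) / D)
        = Λ ^ 4 * 1 * (max (v y - k) 0 ^ (p - 1) * (max (v x - k) 0 * η x ^ p) / D) := by ring
      _ ≤ _ := by
        have : 0 ≤ η x ^ p := Real.rpow_nonneg (hη0 x) p
        gcongr
  have hηx : 0 ≤ η x ^ p := Real.rpow_nonneg (hη0 x) p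
  have hηy : 0 ≤ η y ^ p := Real.rpow_nonneg (hη0 y) p
  have hM : 0 ≤ Λ ^ 4 * p ^ p := by positivity
  by_cases hx : x ∈ ball x₀ ρ <;> by_cases hy : y ∈ ball x₀ ρ
  · have h := mul_kernel_add_nonneg hΛ hD0 hκ hκ' (by positivity) e1
    refine h.trans ?_
    gcongr ?_ + ?_
    · exact le_of_eq (by ring)
    have h1 : ∀ x y : Rn n, ‖x - y‖ ^ ((n : ℝ) + s * p) = D → x ∈ ball x₀ ρ → y ∈ ball x₀ ρ →
        max (v x - k) 0 ^ p * (|η x - η y| ^ p / D)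
          ≤ caccioppoliError n s p v k x₀ ρ c L x y := by
      intro x y hD hx hy
      have : y ∉ (ball x₀ ρ)ᶜ := fun h => h hy
      unfold caccioppoliError
      rw [indicator_of_mem hx, indicator_of_notMem this, mul_zero, add_zero, hD]
      gcongr
      exact hηL x y
    have h2 := h1 x y rfl hx hy
    have h3 := h1 y x hD' hy hx
    rw [abs_sub_comm] at h3
    calc Λ ^ 3 * (Λ * p ^ p * (max (v x - k) 0 ^ p + max (v y - k) 0 ^ p) * |η x - η y| ^ p / D)
        = Λ ^ 4 * p ^ p * (max (v x - k) 0 ^ p * (|η x - η y| ^ p / D)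
          + max (v y - k) 0 ^ p * (|η x - η y| ^ p / D)) := by ring
      _ ≤ _ := by gcongr
  · have h := mul_kernel_add_nonneg hΛ hD0 hκ hκ' (by positivity) (e4 (hηs y hy))
    have h1 := far x y rfl hx hy
    rw [mul_add (Λ ^ 4 * p ^ p)]
    have h2 := mul_nonneg hM hE2
    linarith
  · have h := mul_kernel_add_nonneg hΛ hD0 hκ hκ' (by positivity) (e3 (hηs x hx))
    have h1 := far y x hD' hy hx
    rw [mul_add (Λ ^ 4 * p ^ p)]
    have h2 := mul_nonneg hM hE1
    linarith
  · rw [hηs x hx, hηs y hy, Real.zero_rpow hp0]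
    simp only [mul_zero, sub_self, zero_mul, zero_add]
    positivity

lemma truncation_kernel_le_form_add_error (hs : 0 < s) (hp : 1 < p) (hΛ : 1 ≤ Λ)
    (hΦ : PhiBounds Λ p Φ) (hK : KernelBounds n Λ s p K) (hc : 0 ≤ c) (hL : 0 ≤ L)
    (hη0 : ∀ x, 0 ≤ η x) {x y : Rn n} (hx : η x = 1) (hy : v y ≤ k) :
    max (v x - k) 0 ^ p * (1 / ‖x - y‖ ^ ((n : ℝ) + s * p))
      ≤ Λ ^ 2 * (Φ (v x - v y) * (max (v x - k) 0 * η x ^ p - max (v y - k) 0 * η y ^ p) * K x y)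
      + Λ ^ 4 * p ^ p * (caccioppoliError n s p v k x₀ ρ c L x y
        + caccioppoliError n s p v k x₀ ρ c L y x) := by
  have hE1 := caccioppoliError_nonneg (n := n) (s := s) (p := p) (v := v) (k := k) (x₀ := x₀)
    (ρ := ρ) hc hL x y
  have hE2 := caccioppoliError_nonneg (n := n) (s := s) (p := p) (v := v) (k := k) (x₀ := x₀)
    (ρ := ρ) hc hL y x
  have hE : 0 ≤ Λ ^ 4 * p ^ p * (caccioppoliError n s p v k x₀ ρ c L x y
        + caccioppoliError n s p v k x₀ ρ c L y x) := by positivity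
  rcases eq_or_ne x y with rfl | hxy
  · have hd : (n : ℝ) + s * p ≠ 0 := by positivity
    simp only [sub_self, norm_zero, Real.zero_rpow hd, div_zero, mul_zero, zero_mul, zero_add]
    exact hE
  have hD0 : 0 < ‖x - y‖ ^ ((n : ℝ) + s * p) :=
    Real.rpow_pos_of_pos (norm_pos_iff.2 (sub_ne_zero.2 hxy)) _
  obtain ⟨-, e2, -, -⟩ := hΦ.pair_estimates hp hΛ k (v x) (v y) (hη0 x) (hη0 y)
  have h := le_mul_kernel hΛ hD0 (hK.2 x y hxy).1 (G := max (v x - k) 0 ^ p * η x ^ p)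
    (mul_nonneg (by positivity) (Real.rpow_nonneg (hη0 x) p)) (e2 hy)
  rw [hx, Real.one_rpow, mul_one] at h
  rw [hx, Real.one_rpow, mul_one, mul_one_div]
  linarith

end pointwise

lemma lintegral_ofReal_indicator {α : Type*} [MeasurableSpace α] {μ : Measure α} {S : Set α}
    (hS : MeasurableSet S) (f : α → ℝ) :
    ∫⁻ a, ENNReal.ofReal (S.indicator f a) ∂μ = ∫⁻ a in S, ENNReal.ofReal (f a) ∂μ := by
  rw [← lintegral_indicator hS]
  congr with a
  by_cases ha : a ∈ S <;> simp [ha]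

lemma lintegral_caccioppoliError_le {n : ℕ} {s p C : ℝ} {v : Rn n → ℝ} (hv : Measurable v)
    {k : ℝ} {x₀ : Rn n} {ρ c L : ℝ} (hc : 0 ≤ c) (hL : 0 < L)
    (hker : ∀ x : Rn n,
      ∫⁻ y : Rn n, ENNReal.ofReal (min 1 (L * ‖x - y‖) ^ p / ‖x - y‖ ^ ((n : ℝ) + s * p))
        ≤ ENNReal.ofReal (C * L ^ (s * p))) :
    ∫⁻ w : Rn n × Rn n, ENNReal.ofReal (caccioppoliError n s p v k x₀ ρ c L w.1 w.2)
        ∂(volume.prod volume)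
      ≤ ENNReal.ofReal (C * L ^ (s * p)) * (∫⁻ x in ball x₀ ρ, ENNReal.ofReal (max (v x - k) 0 ^ p))
        + ENNReal.ofReal c * (∫⁻ x in ball x₀ ρ, ENNReal.ofReal (max (v x - k) 0))
          * ∫⁻ y in (ball x₀ ρ)ᶜ,
            ENNReal.ofReal (|v y| ^ (p - 1) / ‖y - x₀‖ ^ ((n : ℝ) + s * p)) := by
  rw [← lintegral_ofReal_indicator measurableSet_ball,
    ← lintegral_ofReal_indicator measurableSet_ball,
    ← lintegral_ofReal_indicator measurableSet_ball.compl,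
    lintegral_prod _ (measurable_caccioppoliError hv).ennreal_ofReal.aemeasurable]
  unfold caccioppoliError
  set β := (ball x₀ ρ).indicator fun x => max (v x - k) 0 ^ p with hβ
  set α := (ball x₀ ρ).indicator fun x => max (v x - k) 0 with hα
  set θ := (ball x₀ ρ)ᶜ.indicator
    fun y => |v y| ^ (p - 1) / ‖y - x₀‖ ^ ((n : ℝ) + s * p) with hθ
  have hβm : Measurable β :=
    (by fun_prop : Measurable fun x => max (v x - k) 0 ^ p).indicator measurableSet_ball
  have hαm : Measurable α :=
    (by fun_prop : Measurable fun x => max (v x - k) 0).indicator measurableSet_ball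
  have hβ0 : ∀ x, 0 ≤ β x := indicator_nonneg fun x _ => by positivity
  have hα0 : ∀ x, 0 ≤ α x := indicator_nonneg fun x _ => le_max_right _ _
  have hθ0 : ∀ x, 0 ≤ θ x := indicator_nonneg fun x _ => by positivity
  calc ∫⁻ x, ∫⁻ y, ENNReal.ofReal
        (β x * (min 1 (L * ‖x - y‖) ^ p / ‖x - y‖ ^ ((n : ℝ) + s * p)) + c * α x * θ y)
      ≤ ∫⁻ x, (ENNReal.ofReal (C * L ^ (s * p)) * ENNReal.ofReal (β x)
        + ENNReal.ofReal c * (∫⁻ y, ENNReal.ofReal (θ y)) * ENNReal.ofReal (α x)) := by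
        refine lintegral_mono fun x => ?_
        have e : ∀ y, ENNReal.ofReal
            (β x * (min 1 (L * ‖x - y‖) ^ p / ‖x - y‖ ^ ((n : ℝ) + s * p)) + c * α x * θ y)
            = ENNReal.ofReal (β x)
              * ENNReal.ofReal (min 1 (L * ‖x - y‖) ^ p / ‖x - y‖ ^ ((n : ℝ) + s * p))
              + ENNReal.ofReal (c * α x) * ENNReal.ofReal (θ y) := fun y => by
          have := hβ0 x
          have := hα0 x
          have := hθ0 y
          rw [ENNReal.ofReal_add (by positivity) (by positivity), ENNReal.ofReal_mul (hβ0 x),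
            ENNReal.ofReal_mul (q := θ y) (by positivity)]
        simp only [e]
        rw [lintegral_add_left (by fun_prop), lintegral_const_mul' _ _ ENNReal.ofReal_ne_top,
          lintegral_const_mul' _ _ ENNReal.ofReal_ne_top, ENNReal.ofReal_mul hc]
        have h := hker x
        calc _ ≤ ENNReal.ofReal (β x) * ENNReal.ofReal (C * L ^ (s * p))
              + ENNReal.ofReal c * ENNReal.ofReal (α x) * ∫⁻ y, ENNReal.ofReal (θ y) := by gcongr
          _ = _ := by ring
    _ = _ := by
        rw [lintegral_add_left (by fun_prop), lintegral_const_mul' _ _ ENNReal.ofReal_ne_top,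
          lintegral_const_mul _ (by fun_prop)]
        ring

lemma kernel_le_of_mem_ball_of_notMem_ball {n : ℕ} {d ρ h : ℝ} (hd : 0 < d) {x₀ x y : Rn n}
    (hh : 0 < h) (hρ : 0 < ρ) (hx : x ∈ ball x₀ (ρ - h)) (hy : y ∉ ball x₀ ρ) :
    1 / ‖x - y‖ ^ d ≤ (ρ / h) ^ d / ‖y - x₀‖ ^ d := by
  have h1 : ‖x - x₀‖ < ρ - h := by rw [← dist_eq_norm]; simpa using hx
  have h2 : ρ ≤ ‖y - x₀‖ := by rw [← dist_eq_norm]; simpa using hy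
  have h3 : ‖y - x₀‖ ≤ ‖x - y‖ + ‖x - x₀‖ := by
    rw [norm_sub_rev x y]
    calc ‖y - x₀‖ = ‖(y - x) + (x - x₀)‖ := by congr 1; abel
      _ ≤ _ := norm_add_le _ _
  have h4 : 0 < ‖x - y‖ := by linarith
  have h5 : 0 < ‖y - x₀‖ := by linarith
  have h6 : ‖y - x₀‖ * h ≤ ρ * ‖x - y‖ := by
    have h7 : 0 ≤ (‖y - x₀‖ - ρ) * (ρ - h) :=
      mul_nonneg (by linarith) (by linarith [norm_nonneg (x - x₀)])
    have h8 : ρ * (‖y - x₀‖ - (ρ - h)) ≤ ρ * ‖x - y‖ := by gcongr; linarith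
    linarith
  rw [← Real.div_rpow (by positivity) h5.le, one_div, ← Real.inv_rpow h4.le]
  refine Real.rpow_le_rpow (by positivity) ?_ hd.le
  rw [div_div, inv_eq_one_div, div_le_div_iff₀ h4 (by positivity)]
  linarith

lemma caccioppoli {n : ℕ} {s p Λ C : ℝ} {Φ : ℝ → ℝ} {K : Rn n → Rn n → ℝ} {v : Rn n → ℝ}
    {Ω : Set (Rn n)} {x₀ : Rn n} {ρ₁ ρ₂ k : ℝ} (hn : 2 ≤ n) (hs : 0 < s) (hs1 : s < 1)
    (hp : 1 < p) (hΛ : 1 ≤ Λ) (hΦ : PhiBounds Λ p Φ) (hK : KernelBounds n Λ s p K)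
    (hv : Measurable v) (hvp : ∫⁻ x, ENNReal.ofReal (|v x| ^ p) < ⊤)
    (hg : gagliardo n s p univ v < ⊤)
    (hsol : ∀ φ : Rn n → ℝ, IsTestFun n Ω φ → nonlocalForm n Φ K v φ = 0)
    (hC : ∀ L : ℝ, 0 < L → ∀ x : Rn n,
      ∫⁻ y : Rn n, ENNReal.ofReal (min 1 (L * ‖x - y‖) ^ p / ‖x - y‖ ^ ((n : ℝ) + s * p))
        ≤ ENNReal.ofReal (C * L ^ (s * p)))
    (hk : 0 ≤ k) (hρ₁ : 0 < ρ₁) (hρ : ρ₁ < ρ₂) (hΩ : ball x₀ ρ₂ ⊆ Ω) :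
    ∫⁻ x in ball x₀ ρ₁, ENNReal.ofReal (max (v x - k) 0 ^ p)
        * ∫⁻ y in ball x₀ ρ₂ \ {y | k < v y}, ENNReal.ofReal (1 / ‖x - y‖ ^ ((n : ℝ) + s * p))
      ≤ ENNReal.ofReal (2 * (Λ ^ 4 * p ^ p)) *
        (ENNReal.ofReal (C * (2 / (ρ₂ - ρ₁)) ^ (s * p))
          * (∫⁻ x in ball x₀ ρ₂, ENNReal.ofReal (max (v x - k) 0 ^ p))
        + ENNReal.ofReal ((ρ₂ / ((ρ₂ - ρ₁) / 2)) ^ ((n : ℝ) + s * p))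
          * (∫⁻ x in ball x₀ ρ₂, ENNReal.ofReal (max (v x - k) 0))
          * ∫⁻ y in (ball x₀ ρ₂)ᶜ,
            ENNReal.ofReal (|v y| ^ (p - 1) / ‖y - x₀‖ ^ ((n : ℝ) + s * p))) := by
  set h := ρ₂ - ρ₁ with hh
  have hh0 : 0 < h := by linarith
  set L := 2 / h with hLdef
  have hL : 0 < L := by positivity
  set m := ρ₂ - h / 2 with hm
  set d := (n : ℝ) + s * p with hd
  have hd0 : 0 < d := by positivity
  set c := (ρ₂ / (h / 2)) ^ d with hcdef
  have hc : 0 ≤ c := Real.rpow_nonneg (by have : 0 < ρ₂ := by linarith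
                                          positivity) _
  set η := radialCutoff x₀ m L with hη
  have hηm : Measurable η := measurable_radialCutoff
  have hη0 : ∀ x, 0 ≤ η x := radialCutoff_nonneg
  have hη1 : ∀ x, η x ≤ 1 := radialCutoff_le_one
  have hηm0 : ∀ x, x ∉ ball x₀ m → η x = 0 := fun x hx => radialCutoff_eq_zero hL hx
  have hηs : ∀ x, x ∉ ball x₀ ρ₂ → η x = 0 := fun x hx =>
    hηm0 x fun h' => hx (ball_subset_ball (by linarith) h')
  have hηL : ∀ x y, |η x - η y| ≤ min 1 (L * ‖x - y‖) := abs_radialCutoff_sub_le hL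
  have hfar : ∀ x y, η x ≠ 0 → y ∉ ball x₀ ρ₂ → 1 / ‖x - y‖ ^ d ≤ c / ‖y - x₀‖ ^ d := by
    intro x y hx hy
    exact kernel_le_of_mem_ball_of_notMem_ball hd0 (by positivity) (by linarith)
      (by by_contra h'; exact hx (hηm0 x h')) hy
  have hη1' : ∀ x ∈ ball x₀ ρ₁, η x = 1 := fun x hx =>
    radialCutoff_eq_one hL (by rw [hLdef, one_div_div, hm]; linarith) hx
  obtain ⟨hI, hI0⟩ := integral_form_eq_zero (φ := fun x => max (v x - k) 0 * η x ^ p)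
    (ρ := m) hp hΛ hΦ hK hv hg hsol (by fun_prop)
    (integrable_truncation_mul_cutoff hp hk hL hv hvp x₀)
    (gagliardo_truncation_mul_cutoff_lt_top hn hs hs1 hp hk hL hv hvp hg x₀)
    (fun x hx => by rw [hηm0 x hx, Real.zero_rpow (by linarith), mul_zero])
    (by linarith : m < ρ₂) hΩ
  set E := caccioppoliError n s p v k x₀ ρ₂ c L with hE
  have hE0 : ∀ x y, 0 ≤ E x y := fun x y => caccioppoliError_nonneg hc hL.le x y
  have hEm : Measurable fun w : Rn n × Rn n => E w.1 w.2 := measurable_caccioppoliError hv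
  have hEm' : Measurable fun w : Rn n × Rn n => E w.2 w.1 :=
    hEm.comp (f := fun w : Rn n × Rn n => (w.2, w.1)) (by fun_prop)
  set S : Set (Rn n) := ball x₀ ρ₂ \ {y | k < v y} with hS
  have hSm : MeasurableSet S := measurableSet_ball.diff (measurableSet_lt measurable_const hv)
  have hBS : MeasurableSet (ball x₀ ρ₁ ×ˢ S) := measurableSet_ball.prod hSm
  set M := Λ ^ 4 * p ^ p with hM
  have hM0 : 0 ≤ M := by positivity
  set I : Rn n × Rn n → ℝ := fun w => Λ ^ 2 * (Φ (v w.1 - v w.2)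
    * (max (v w.1 - k) 0 * η w.1 ^ p - max (v w.2 - k) 0 * η w.2 ^ p) * K w.1 w.2) with hIdef
  have hIi : Integrable I (volume.prod volume) := hI.const_mul (Λ ^ 2)
  have hIz : ∫ w, I w ∂(volume.prod volume) = 0 := by
    rw [hIdef, integral_const_mul, hI0, mul_zero]
  set G : Rn n × Rn n → ℝ := (ball x₀ ρ₁ ×ˢ S).indicator
      fun w => max (v w.1 - k) 0 ^ p * (1 / ‖w.1 - w.2‖ ^ d) with hG
  have hG0 : ∀ w, 0 ≤ G w := indicator_nonneg fun w _ => by positivity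
  have hpt : ∀ w, G w ≤ I w + M * (E w.1 w.2 + E w.2 w.1) := fun w => by
    by_cases hw : w ∈ ball x₀ ρ₁ ×ˢ S
    · rw [hG, indicator_of_mem hw]
      exact truncation_kernel_le_form_add_error hs hp hΛ hΦ hK hc hL.le hη0 (hη1' _ hw.1)
        (not_lt.1 hw.2.2)
    · rw [hG, indicator_of_notMem hw]
      exact form_add_error_nonneg hp hΛ hΦ hK hk hc hL.le hη0 hη1 hηs hηL hfar _ _
  have key := lintegral_ofReal_le_of_le_add hIi hIz (by fun_prop)
    (fun w => mul_nonneg hM0 (add_nonneg (hE0 _ _) (hE0 _ _))) hG0 hpt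
  rw [lintegral_ofReal_indicator hBS,
    setLIntegral_prod _ (Measurable.aemeasurable (by fun_prop))] at key
  have hswap : ∫⁻ w : Rn n × Rn n, ENNReal.ofReal (E w.2 w.1) ∂(volume.prod volume)
      = ∫⁻ w : Rn n × Rn n, ENNReal.ofReal (E w.1 w.2) ∂(volume.prod volume) :=
    lintegral_prod_swap (fun w : Rn n × Rn n => ENNReal.ofReal (E w.1 w.2))
  calc ∫⁻ x in ball x₀ ρ₁, ENNReal.ofReal (max (v x - k) 0 ^ p)
        * ∫⁻ y in S, ENNReal.ofReal (1 / ‖x - y‖ ^ d)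
      = ∫⁻ x in ball x₀ ρ₁, ∫⁻ y in S,
          ENNReal.ofReal (max (v x - k) 0 ^ p * (1 / ‖x - y‖ ^ d)) := by
        refine lintegral_congr fun x => ?_
        rw [← lintegral_const_mul' _ _ ENNReal.ofReal_ne_top]
        refine lintegral_congr fun y => ?_
        rw [ENNReal.ofReal_mul (by positivity)]
    _ ≤ _ := key
    _ = ENNReal.ofReal (2 * M) * ∫⁻ w : Rn n × Rn n, ENNReal.ofReal (E w.1 w.2)
          ∂(volume.prod volume) := by
        have e : ∀ w : Rn n × Rn n, ENNReal.ofReal (M * (E w.1 w.2 + E w.2 w.1))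
            = ENNReal.ofReal M * (ENNReal.ofReal (E w.1 w.2) + ENNReal.ofReal (E w.2 w.1)) :=
          fun w => by rw [ENNReal.ofReal_mul hM0, ENNReal.ofReal_add (hE0 _ _) (hE0 _ _)]
        simp only [e]
        rw [lintegral_const_mul' _ _ ENNReal.ofReal_ne_top, lintegral_add_left (by fun_prop),
          hswap, ENNReal.ofReal_mul zero_le_two, ENNReal.ofReal_ofNat]
        ring
    _ ≤ _ := by
        gcongr
        exact lintegral_caccioppoliError_le hv hc hL (hC L hL)

/-! ### De Giorgi iteration -/

/-- `v` is a measurable finite-energy solution in `Ω` of some equation in the class with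
ellipticity constant `Λ`. -/
def IsEnergySol (n : ℕ) (s p Λ : ℝ) (Ω : Set (Rn n)) (v : Rn n → ℝ) : Prop :=
  Measurable v ∧ (∫⁻ x, ENNReal.ofReal (|v x| ^ p)) < ⊤ ∧ gagliardo n s p univ v < ⊤ ∧
    ∃ (Φ : ℝ → ℝ) (K : Rn n → Rn n → ℝ), PhiBounds Λ p Φ ∧ KernelBounds n Λ s p K ∧
      ∀ φ : Rn n → ℝ, IsTestFun n Ω φ → nonlocalForm n Φ K v φ = 0

lemma IsEnergySol.neg {n : ℕ} {s p Λ : ℝ} {Ω : Set (Rn n)} {v : Rn n → ℝ}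
    (h : IsEnergySol n s p Λ Ω v) : IsEnergySol n s p Λ Ω fun x => -v x := by
  obtain ⟨hv, hvp, hg, Φ, K, hΦ, hK, hsol⟩ := h
  refine ⟨hv.neg, by simpa using hvp, ?_, fun t => -Φ (-t), K, hΦ.neg, hK, fun φ hφ => ?_⟩
  · unfold gagliardo at hg ⊢
    convert hg using 8 with x y
    rw [← abs_neg]
    congr 1
    ring
  · have h := hsol φ hφ
    unfold nonlocalForm at h ⊢
    have e : ∀ x y, -Φ (-(-v x - -v y)) * (φ x - φ y) * K x y
        = -(Φ (v x - v y) * (φ x - φ y) * K x y) := fun x y => by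
      rw [show -(-v x - -v y) = v x - v y by ring]; ring
    simp only [e, integral_neg, h, neg_zero]

/-- The density of the nonlocal tail centred at `x₀`. -/
def tailDensity (n : ℕ) (s p : ℝ) (v : Rn n → ℝ) (x₀ y : Rn n) : ℝ :=
  |v y| ^ (p - 1) / ‖y - x₀‖ ^ ((n : ℝ) + s * p)

lemma exists_energy_decay {n : ℕ} {s p Λ : ℝ} (hn : 2 ≤ n) (hs : 0 < s) (hs1 : s < 1)
    (hp : 1 < p) (hΛ : 1 ≤ Λ) :
    ∃ C : ℝ, 0 < C ∧ ∀ (Ω : Set (Rn n)) (v : Rn n → ℝ) (x₀ : Rn n) (ρ₁ ρ₂ k a : ℝ),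
      IsEnergySol n s p Λ Ω v → 0 ≤ k → 0 < ρ₁ → ρ₁ < ρ₂ → ball x₀ ρ₂ ⊆ Ω → 0 < a →
      volume {y ∈ ball x₀ ρ₂ | k < v y} ≤ ENNReal.ofReal a →
      ∫⁻ x in ball x₀ ρ₁, ENNReal.ofReal (max (v x - k) 0 ^ p) ≤
        ENNReal.ofReal (C * a ^ (s * p / n)) *
          (ENNReal.ofReal ((ρ₂ - ρ₁) ^ (-(s * p)))
            * (∫⁻ x in ball x₀ ρ₂, ENNReal.ofReal (max (v x - k) 0 ^ p))
          + ENNReal.ofReal ((ρ₂ / (ρ₂ - ρ₁)) ^ ((n : ℝ) + s * p))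
            * (∫⁻ x in ball x₀ ρ₂, ENNReal.ofReal (max (v x - k) 0))
            * ∫⁻ y in (ball x₀ ρ₂)ᶜ, ENNReal.ofReal (tailDensity n s p v x₀ y)) := by
  obtain ⟨C₀, hC₀, hker⟩ := exists_truncated_kernel_bound hn hs hs1 hp
  have : Nontrivial (Rn n) := by
    have : Nonempty (Fin n) := ⟨⟨0, by lia⟩⟩
    infer_instance
  set ω : ℝ := (volume (ball (0 : Rn n) 1)).toReal with hω
  have hω0 : 0 < ω := ENNReal.toReal_pos (measure_ball_pos _ _ one_pos).ne'
    measure_ball_lt_top.ne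
  have hωe : volume (ball (0 : Rn n) 1) = ENNReal.ofReal ω :=
    (ENNReal.ofReal_toReal measure_ball_lt_top.ne).symm
  have hn0 : (0 : ℝ) < n := by exact_mod_cast (by lia : 0 < n)
  have hsp : 0 < s * p := by positivity
  set d := (n : ℝ) + s * p with hd
  set N := 2 * (Λ ^ 4 * p ^ p) * (C₀ * 2 ^ (s * p) + 2 ^ d) with hN
  have hN0 : 0 < N := by positivity
  refine ⟨(2 / ω) ^ (s * p / n) * (1 + 2 / ω * N), by positivity, ?_⟩
  rintro Ω v x₀ ρ₁ ρ₂ k a ⟨hv, hvp, hg, Φ, K, hΦ, hK, hsol⟩ hk hρ₁ hρ hΩ ha hA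
  set h := ρ₂ - ρ₁ with hh
  have hh0 : 0 < h := by linarith
  set τ := (2 * a / ω) ^ (1 / (n : ℝ)) with hτ
  have hτ0 : 0 < τ := by positivity
  have hτn : τ ^ n = 2 * a / ω := by
    rw [hτ, ← Real.rpow_natCast, ← Real.rpow_mul (by positivity), one_div,
      inv_mul_cancel₀ hn0.ne', Real.rpow_one]
  have hτsp : τ ^ (s * p) = (2 / ω) ^ (s * p / n) * a ^ (s * p / n) := by
    rw [hτ, ← Real.rpow_mul (by positivity), ← Real.mul_rpow (by positivity) ha.le]
    congr 1 <;> ring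
  set Y₁ := ∫⁻ x in ball x₀ ρ₁, ENNReal.ofReal (max (v x - k) 0 ^ p) with hY₁
  set Y₂ := ∫⁻ x in ball x₀ ρ₂, ENNReal.ofReal (max (v x - k) 0 ^ p) with hY₂
  set W := ∫⁻ x in ball x₀ ρ₂, ENNReal.ofReal (max (v x - k) 0) with hW
  set t := ∫⁻ y in (ball x₀ ρ₂)ᶜ, ENNReal.ofReal (tailDensity n s p v x₀ y) with ht
  have hconst : (2 / ω) ^ (s * p / n) * (1 + 2 / ω * N) * a ^ (s * p / n)
      = τ ^ (s * p) + 2 / ω * τ ^ (s * p) * N := by rw [hτsp]; ring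
  rw [hconst]
  rcases le_or_gt τ h with hle | hgt
  · have hA2 : 2 * volume {y | k < v y ∧ y ∈ ball x₀ ρ₂} ≤ volume (ball (0 : Rn n) τ) := by
      rw [Measure.addHaar_ball _ _ hτ0.le, hωe, finrank_euclideanSpace, Fintype.card_fin, hτn,
        ← ENNReal.ofReal_mul (by positivity), div_mul_cancel₀ _ hω0.ne',
        ENNReal.ofReal_mul zero_le_two, ENNReal.ofReal_ofNat]
      gcongr
      refine le_trans (measure_mono fun y hy => ?_) hA
      exact ⟨hy.2, hy.1⟩
    have h1 : ENNReal.ofReal (ω / 2 * τ ^ (-(s * p))) * Y₁ ≤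
        ∫⁻ x in ball x₀ ρ₁, ENNReal.ofReal (max (v x - k) 0 ^ p)
          * ∫⁻ y in ball x₀ ρ₂ \ {y | k < v y}, ENNReal.ofReal (1 / ‖x - y‖ ^ d) := by
      rw [hY₁, ← lintegral_const_mul' _ _ ENNReal.ofReal_ne_top]
      refine setLIntegral_mono' measurableSet_ball fun x hx => ?_
      rw [mul_comm]
      gcongr
      have hB : ball x τ ⊆ ball x₀ ρ₂ := ball_subset_ball' (by
        have := mem_ball.1 hx
        linarith)
      have h2 := lintegral_kernel_compl_ge hn hs hp hτ0 hB hA2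
      rw [hωe] at h2
      have hset : ball x₀ ρ₂ \ {y | k < v y ∧ y ∈ ball x₀ ρ₂} = ball x₀ ρ₂ \ {y | k < v y} := by
        ext y
        exact ⟨fun hy => ⟨hy.1, fun h' => hy.2 ⟨h', hy.1⟩⟩, fun hy => ⟨hy.1, fun h' => hy.2 h'.1⟩⟩
      rw [hset] at h2
      refine le_trans (le_of_eq ?_) h2
      rw [ENNReal.ofReal_mul (by positivity), ENNReal.ofReal_div_of_pos two_pos,
        ENNReal.ofReal_ofNat]
    have h2 := h1.trans (caccioppoli hn hs hs1 hp hΛ hΦ hK hv hvp hg hsol hker hk hρ₁ hρ hΩ)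
    have h3 : ENNReal.ofReal (2 * (Λ ^ 4 * p ^ p)) *
        (ENNReal.ofReal (C₀ * (2 / h) ^ (s * p)) * Y₂
          + ENNReal.ofReal ((ρ₂ / (h / 2)) ^ d) * W * t)
        ≤ ENNReal.ofReal N * (ENNReal.ofReal (h ^ (-(s * p))) * Y₂
          + ENNReal.ofReal ((ρ₂ / h) ^ d) * W * t) := by
      rw [hN, ENNReal.ofReal_mul (q := C₀ * 2 ^ (s * p) + 2 ^ d) (by positivity),
        mul_assoc (ENNReal.ofReal (2 * (Λ ^ 4 * p ^ p)))]
      gcongr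
      rw [mul_add]
      gcongr ?_ + ?_
      · rw [← mul_assoc, ← ENNReal.ofReal_mul (by positivity)]
        refine mul_le_mul' (ENNReal.ofReal_le_ofReal ?_) le_rfl
        rw [Real.div_rpow zero_le_two hh0.le, Real.rpow_neg hh0.le, add_mul, div_eq_mul_inv,
          ← mul_assoc]
        exact le_add_of_nonneg_right (by positivity)
      · rw [← mul_assoc, ← mul_assoc, ← ENNReal.ofReal_mul (by positivity)]
        have hρ₂ : 0 < ρ₂ := by linarith
        refine mul_le_mul' (mul_le_mul' (ENNReal.ofReal_le_ofReal ?_) le_rfl) le_rfl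
        rw [show ρ₂ / (h / 2) = 2 * (ρ₂ / h) by field_simp, Real.mul_rpow zero_le_two
          (by positivity), add_mul]
        exact le_add_of_nonneg_left (by positivity)
    have h4 := h2.trans h3
    calc Y₁ = ENNReal.ofReal (2 / ω * τ ^ (s * p))
          * (ENNReal.ofReal (ω / 2 * τ ^ (-(s * p))) * Y₁) := by
          rw [← mul_assoc, ← ENNReal.ofReal_mul (by positivity), Real.rpow_neg hτ0.le]
          have : 0 < τ ^ (s * p) := by positivity
          rw [show 2 / ω * τ ^ (s * p) * (ω / 2 * (τ ^ (s * p))⁻¹) = 1 by field_simp]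
          simp
      _ ≤ ENNReal.ofReal (2 / ω * τ ^ (s * p)) * (ENNReal.ofReal N *
          (ENNReal.ofReal (h ^ (-(s * p))) * Y₂ + ENNReal.ofReal ((ρ₂ / h) ^ d) * W * t)) := by
          gcongr
      _ ≤ _ := by
          rw [← mul_assoc, ← ENNReal.ofReal_mul (by positivity)]
          gcongr
          exact le_add_of_nonneg_left (by positivity)
  · have h1 : Y₁ ≤ Y₂ := lintegral_mono_set (ball_subset_ball hρ.le)
    have h2 : 1 ≤ τ ^ (s * p) * h ^ (-(s * p)) := by
      rw [Real.rpow_neg hh0.le, ← div_eq_mul_inv, one_le_div (by positivity)]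
      exact Real.rpow_le_rpow hh0.le hgt.le hsp.le
    calc Y₁ ≤ ENNReal.ofReal 1 * Y₂ := by simpa using h1
      _ ≤ ENNReal.ofReal (τ ^ (s * p) * h ^ (-(s * p))) * Y₂ := by gcongr
      _ = ENNReal.ofReal (τ ^ (s * p)) * (ENNReal.ofReal (h ^ (-(s * p))) * Y₂) := by
          rw [ENNReal.ofReal_mul (by positivity), mul_assoc]
      _ ≤ _ := by
          gcongr
          · exact le_add_of_nonneg_right (by positivity)
          · exact le_self_add

lemma volume_superlevel_le {n : ℕ} {p : ℝ} (hp : 1 < p) {v : Rn n → ℝ} (hv : Measurable v)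
    {B : Set (Rn n)} (hB : MeasurableSet B) {k k' δ : ℝ} (hδ : 0 < δ) (hk : k' = k + δ) :
    volume {y ∈ B | k' < v y} ≤
      ENNReal.ofReal (δ ^ (-p)) * ∫⁻ x in B, ENNReal.ofReal (max (v x - k) 0 ^ p) := by
  have hS : MeasurableSet {y ∈ B | k' < v y} := hB.inter (measurableSet_lt measurable_const hv)
  rw [← lintegral_const_mul' _ _ ENNReal.ofReal_ne_top]
  calc volume {y ∈ B | k' < v y} = ∫⁻ _ in {y ∈ B | k' < v y}, 1 := by simp
    _ ≤ ∫⁻ x in {y ∈ B | k' < v y},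
        ENNReal.ofReal (δ ^ (-p)) * ENNReal.ofReal (max (v x - k) 0 ^ p) := by
      refine setLIntegral_mono' hS fun x hx => ?_
      rw [← ENNReal.ofReal_mul (by positivity), ← ENNReal.ofReal_one]
      refine ENNReal.ofReal_le_ofReal ?_
      have hx2 : k' < v x := hx.2
      rw [Real.rpow_neg hδ.le, inv_mul_eq_div, one_le_div (by positivity)]
      exact Real.rpow_le_rpow hδ.le (le_max_of_le_left (by linarith)) (by linarith)
    _ ≤ _ := lintegral_mono_set fun y hy => hy.1

lemma lintegral_excess_le {n : ℕ} {p : ℝ} (hp : 1 < p) {v : Rn n → ℝ}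
    (B : Set (Rn n)) {k k' δ : ℝ} (hδ : 0 < δ) (hk : k' = k + δ) :
    ∫⁻ x in B, ENNReal.ofReal (max (v x - k') 0) ≤
      ENNReal.ofReal (δ ^ (-(p - 1))) * ∫⁻ x in B, ENNReal.ofReal (max (v x - k) 0 ^ p) := by
  rw [← lintegral_const_mul' _ _ ENNReal.ofReal_ne_top]
  refine lintegral_mono fun x => ?_
  simp only
  rw [← ENNReal.ofReal_mul (by positivity)]
  refine ENNReal.ofReal_le_ofReal ?_
  rcases le_or_gt (v x) k' with h | h
  · rw [max_eq_right (by linarith)]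
    positivity
  · have h0 : δ < v x - k := by linarith
    have h1 : 0 < v x - k := by linarith
    rw [max_eq_left (by linarith), max_eq_left h1.le,
      show p = (p - 1) + 1 by ring, Real.rpow_add h1, Real.rpow_one, ← mul_assoc,
      Real.rpow_neg hδ.le, inv_mul_eq_div, add_sub_cancel_right]
    have : 1 ≤ (v x - k) ^ (p - 1) / δ ^ (p - 1) := by
      rw [one_le_div (by positivity)]
      exact Real.rpow_le_rpow hδ.le h0.le (by linarith)
    nlinarith

lemma lintegral_truncation_mono {n : ℕ} {p : ℝ} (hp : 1 < p) (v : Rn n → ℝ)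
    {A B : Set (Rn n)} (hAB : A ⊆ B) {k k' : ℝ} (hk : k ≤ k') :
    ∫⁻ x in A, ENNReal.ofReal (max (v x - k') 0 ^ p) ≤
      ∫⁻ x in B, ENNReal.ofReal (max (v x - k) 0 ^ p) := by
  refine (lintegral_mono fun x => ENNReal.ofReal_le_ofReal ?_).trans (lintegral_mono_set hAB)
  exact Real.rpow_le_rpow (le_max_right _ _) (max_le_max (by linarith) le_rfl) (by linarith)

/-- The algebra of one step of the De Giorgi iteration. -/
lemma deGiorgi_step_bound {n : ℕ} {s p C ν Q M R r κ tl b : ℝ} (hn : 0 < n) (hp : 1 < p)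
    (hC : 0 < C) (hν : 0 < ν) (hQ : 0 < Q) (hM : 1 ≤ M) (hR : 0 < R) (hr : 0 < r)
    (hκ : 0 < κ) (hb : 0 ≤ b)
    (htl : r ^ ((n : ℝ) + s * p) * tl ≤ κ ^ (p - 1) * R ^ n) :
    C * (M ^ p * ν * R ^ n * Q) ^ (s * p / n) *
      ((R / M) ^ (-(s * p)) * b
        + (r / (R / M)) ^ ((n : ℝ) + s * p) * ((κ / M) ^ (-(p - 1)) * b) * tl) ≤
      2 * C * ν ^ (s * p / n) * M ^ ((n : ℝ) + s * p + p + p * (s * p / n))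
        * Q ^ (s * p / n) * b := by
  have hM0 : 0 < M := by linarith
  have hn0 : (0 : ℝ) < n := by exact_mod_cast hn
  set d := (n : ℝ) + s * p with hd
  set α := s * p / n with hα
  have e1 : (R / M) ^ (-(s * p)) ≤ R ^ (-(s * p)) * M ^ (d + p) := by
    rw [Real.div_rpow hR.le hM0.le, Real.rpow_neg hM0.le, div_inv_eq_mul]
    gcongr
    linarith
  have e2 : (r / (R / M)) ^ d * (κ / M) ^ (-(p - 1)) * tl ≤ R ^ (-(s * p)) * M ^ (d + p) := by
    have h1 : (r / (R / M)) ^ d * (κ / M) ^ (-(p - 1)) * tl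
        = (r ^ d * tl) * (M ^ (d + p - 1) / (R ^ d * κ ^ (p - 1))) := by
      rw [show r / (R / M) = r * M / R by field_simp, Real.div_rpow (by positivity) hR.le,
        Real.mul_rpow hr.le hM0.le, Real.div_rpow hκ.le hM0.le, Real.rpow_neg hκ.le,
        Real.rpow_neg hM0.le, show d + p - 1 = d + (p - 1) by ring, Real.rpow_add hM0 d]
      field_simp
    rw [h1]
    calc _ ≤ κ ^ (p - 1) * R ^ n * (M ^ (d + p - 1) / (R ^ d * κ ^ (p - 1))) := by gcongr
      _ = R ^ (-(s * p)) * M ^ (d + p - 1) := by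
        rw [hd, Real.rpow_add hR, Real.rpow_natCast, Real.rpow_neg hR.le]
        field_simp
      _ ≤ _ := by
        gcongr
        linarith
  have e3 : (M ^ p * ν * R ^ n * Q) ^ α = M ^ (p * α) * ν ^ α * R ^ (s * p) * Q ^ α := by
    rw [Real.mul_rpow (by positivity) hQ.le, Real.mul_rpow (by positivity) (by positivity),
      Real.mul_rpow (by positivity) hν.le, ← Real.rpow_mul hM0.le, ← Real.rpow_natCast,
      ← Real.rpow_mul hR.le, hα, mul_div_cancel₀ _ hn0.ne']
  have e4 : (R / M) ^ (-(s * p)) * b + (r / (R / M)) ^ d * ((κ / M) ^ (-(p - 1)) * b) * tl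
      ≤ 2 * (R ^ (-(s * p)) * M ^ (d + p)) * b := by
    have h1 := mul_le_mul_of_nonneg_right e1 hb
    have h2 := mul_le_mul_of_nonneg_right e2 hb
    linarith
  rw [e3]
  calc _ ≤ C * (M ^ (p * α) * ν ^ α * R ^ (s * p) * Q ^ α)
        * (2 * (R ^ (-(s * p)) * M ^ (d + p)) * b) := by gcongr
    _ = _ := by
      rw [Real.rpow_add hM0 (d + p), Real.rpow_neg hR.le]
      field_simp

/-- De Giorgi's criterion: small energy of the positive part bounds the solution from above. -/
lemma exists_deGiorgi_criterion {n : ℕ} {s p Λ : ℝ} (hn : 2 ≤ n) (hs : 0 < s) (hs1 : s < 1)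
    (hp : 1 < p) (hΛ : 1 ≤ Λ) :
    ∃ ν : ℝ, 0 < ν ∧ ∀ (Ω : Set (Rn n)) (v : Rn n → ℝ) (x₀ : Rn n) (r ρ ρ' κ tl : ℝ),
      IsEnergySol n s p Λ Ω v → 0 < r → ball x₀ r ⊆ Ω → r / 2 ≤ ρ → ρ < ρ' → ρ' ≤ r → 0 < κ →
      0 ≤ tl →
      ∫⁻ y in (ball x₀ (r / 2))ᶜ, ENNReal.ofReal (tailDensity n s p v x₀ y) ≤ ENNReal.ofReal tl →
      r ^ ((n : ℝ) + s * p) * tl ≤ κ ^ (p - 1) * (ρ' - ρ) ^ n →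
      ∫⁻ x in ball x₀ ρ', ENNReal.ofReal (max (v x) 0 ^ p) ≤
        ENNReal.ofReal (ν * (κ ^ p * (ρ' - ρ) ^ n)) →
      ∀ᵐ x ∂volume.restrict (ball x₀ ρ), v x ≤ κ := by
  obtain ⟨C, hC, hdecay⟩ := exists_energy_decay hn hs hs1 hp hΛ
  have hn0 : (0 : ℝ) < n := by exact_mod_cast (by lia : 0 < n)
  set α := s * p / n with hα
  have hα0 : 0 < α := by positivity
  set d := (n : ℝ) + s * p with hd
  set E := d + p + p * α with hE
  have hE0 : 0 < E := by positivity
  set q : ℝ := 2 ^ (-(E / α)) with hq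
  have hq0 : 0 < q := by positivity
  have hq1 : q < 1 := Real.rpow_lt_one_of_one_lt_of_neg one_lt_two (by
    rw [neg_lt_zero]; positivity)
  have hqα : 2 ^ E * q ^ α = 1 := by
    rw [hq, ← Real.rpow_mul zero_le_two, ← Real.rpow_add two_pos,
      show E + -(E / α) * α = 0 by field_simp; ring, Real.rpow_zero]
  set ν : ℝ := (q / (2 * C * 2 ^ E)) ^ (1 / α) with hν
  have hν0 : 0 < ν := by positivity
  have hνα : 2 * C * ν ^ α * 2 ^ E = q := by
    rw [hν, ← Real.rpow_mul (by positivity), one_div_mul_cancel hα0.ne', Real.rpow_one]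
    field_simp
  refine ⟨ν, hν0, ?_⟩
  intro Ω v x₀ r ρ ρ' κ tl hsol hr hΩ hρ hρρ' hρ'r hκ htl0 htl htlκ h0
  have hv := hsol.1
  set R := ρ' - ρ with hR
  have hR0 : 0 < R := by linarith
  set rad : ℕ → ℝ := fun j => ρ + R / 2 ^ j with hrad
  set lev : ℕ → ℝ := fun j => κ - κ / 2 ^ j with hlev
  have hpow : ∀ j : ℕ, (1 : ℝ) ≤ 2 ^ j := fun j => one_le_pow₀ one_le_two
  have hlev_le : ∀ j, lev j ≤ κ := fun j => by
    have : 0 < κ / 2 ^ j := by positivity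
    simp only [hlev]
    linarith
  have hlev_nonneg : ∀ j, 0 ≤ lev j := fun j => by
    have : κ / 2 ^ j ≤ κ := div_le_self hκ.le (hpow j)
    simp only [hlev]
    linarith
  have hrad_lt : ∀ j, ρ < rad j := fun j => by
    have : 0 < R / 2 ^ j := by positivity
    simp only [hrad]
    linarith
  have hrad_le : ∀ j, rad j ≤ r := fun j => by
    have : R / 2 ^ j ≤ R := div_le_self hR0.le (hpow j)
    simp only [hrad]
    linarith
  have key : ∀ j : ℕ, ∫⁻ x in ball x₀ (rad j), ENNReal.ofReal (max (v x - lev j) 0 ^ p) ≤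
      ENNReal.ofReal (ν * (κ ^ p * R ^ n) * q ^ j) := by
    intro j
    induction j with
    | zero => simpa [hrad, hlev, hR] using h0
    | succ j ih =>
      set M : ℝ := 2 ^ (j + 1) with hM
      have hM1 : 1 ≤ M := hpow _
      have hM0 : 0 < M := by linarith
      have hlev_succ : lev (j + 1) = lev j + κ / M := by
        simp only [hlev, hM, pow_succ]
        field_simp
        ring
      have hrad_succ : rad j - rad (j + 1) = R / M := by
        simp only [hrad, hM, pow_succ]
        field_simp
        ring
      have hRM : 0 < R / M := by positivity
      have hκM : 0 < κ / M := by positivity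
      set b := ν * (κ ^ p * R ^ n) * q ^ j with hb
      have hb0 : 0 < b := by positivity
      have hvol : volume {y ∈ ball x₀ (rad j) | lev (j + 1) < v y} ≤
          ENNReal.ofReal (M ^ p * ν * R ^ n * q ^ j) := by
        refine (volume_superlevel_le hp hv measurableSet_ball hκM hlev_succ).trans ?_
        refine (mul_le_mul' le_rfl ih).trans ?_
        rw [← ENNReal.ofReal_mul (by positivity)]
        refine ENNReal.ofReal_le_ofReal (le_of_eq ?_)
        rw [hb, Real.div_rpow hκ.le hM0.le, Real.rpow_neg hκ.le, Real.rpow_neg hM0.le]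
        field_simp
      have hstep := hdecay Ω v x₀ (rad (j + 1)) (rad j) (lev (j + 1)) (M ^ p * ν * R ^ n * q ^ j)
        hsol (hlev_nonneg _) (by linarith [hrad_lt (j + 1)]) (by linarith)
        ((ball_subset_ball (hrad_le j)).trans hΩ) (by positivity) hvol
      have hY : ∫⁻ x in ball x₀ (rad j), ENNReal.ofReal (max (v x - lev (j + 1)) 0 ^ p) ≤
          ENNReal.ofReal b :=
        (lintegral_truncation_mono hp v subset_rfl (by linarith)).trans ih
      have hW : ∫⁻ x in ball x₀ (rad j), ENNReal.ofReal (max (v x - lev (j + 1)) 0) ≤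
          ENNReal.ofReal ((κ / M) ^ (-(p - 1)) * b) := by
        refine (lintegral_excess_le hp _ hκM hlev_succ).trans ?_
        rw [ENNReal.ofReal_mul (by positivity)]
        exact mul_le_mul' le_rfl ih
      have ht : ∫⁻ y in (ball x₀ (rad j))ᶜ, ENNReal.ofReal (tailDensity n s p v x₀ y) ≤
          ENNReal.ofReal tl := by
        refine le_trans (lintegral_mono_set ?_) htl
        exact compl_subset_compl.2 (ball_subset_ball (by linarith [hrad_lt j]))
      have hradj : 0 < rad j := by linarith [hrad_lt j]
      have hfac : (rad j / (R / M)) ^ d ≤ (r / (R / M)) ^ d :=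
        Real.rpow_le_rpow (by positivity) (by gcongr; exact hrad_le j) (by positivity)
      rw [hrad_succ] at hstep
      refine hstep.trans ?_
      calc _ ≤ ENNReal.ofReal (C * (M ^ p * ν * R ^ n * q ^ j) ^ α) *
            (ENNReal.ofReal ((R / M) ^ (-(s * p))) * ENNReal.ofReal b
              + ENNReal.ofReal ((r / (R / M)) ^ d) * ENNReal.ofReal ((κ / M) ^ (-(p - 1)) * b)
                * ENNReal.ofReal tl) := by
            refine mul_le_mul' le_rfl (add_le_add (mul_le_mul' le_rfl hY) ?_)
            exact mul_le_mul' (mul_le_mul' (ENNReal.ofReal_le_ofReal hfac) hW) ht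
        _ = ENNReal.ofReal (C * (M ^ p * ν * R ^ n * q ^ j) ^ α *
            ((R / M) ^ (-(s * p)) * b
              + (r / (R / M)) ^ d * ((κ / M) ^ (-(p - 1)) * b) * tl)) := by
            rw [ENNReal.ofReal_mul (p := C * (M ^ p * ν * R ^ n * q ^ j) ^ α) (by positivity),
              ENNReal.ofReal_add (by positivity) (by positivity),
              ENNReal.ofReal_mul (p := (R / M) ^ (-(s * p))) (by positivity),
              ENNReal.ofReal_mul (q := tl) (by positivity),
              ENNReal.ofReal_mul (p := (r / (R / M)) ^ d) (by positivity)]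
        _ ≤ _ := by
            refine ENNReal.ofReal_le_ofReal ?_
            refine (deGiorgi_step_bound (by lia) hp hC hν0 (pow_pos hq0 j) hM1 hR0 hr hκ
              hb0.le htlκ).trans (le_of_eq ?_)
            have hME : M ^ E = 2 ^ E * (2 ^ E) ^ j := by
              rw [hM, ← Real.rpow_natCast, ← Real.rpow_mul zero_le_two, mul_comm,
                Real.rpow_mul zero_le_two, Real.rpow_natCast, pow_succ, mul_comm]
            have hqj : (q ^ j) ^ α = (q ^ α) ^ j := by
              rw [← Real.rpow_natCast, ← Real.rpow_mul hq0.le, mul_comm,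
                Real.rpow_mul hq0.le, Real.rpow_natCast]
            rw [hqj, ← hα, ← hd, ← hE, hME]
            calc _ = 2 * C * ν ^ α * 2 ^ E * (2 ^ E * q ^ α) ^ j * b := by rw [mul_pow]; ring
              _ = q * b := by rw [hqα, hνα, one_pow, mul_one]
              _ = _ := by rw [hb]; ring
  have hzero : ∫⁻ x in ball x₀ ρ, ENNReal.ofReal (max (v x - κ) 0 ^ p) = 0 := by
    refine le_antisymm (ge_of_tendsto' (f := fun j : ℕ =>
      ENNReal.ofReal (ν * (κ ^ p * R ^ n) * q ^ j)) (x := atTop) ?_ fun j => ?_) zero_le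
    · rw [← ENNReal.ofReal_zero]
      refine ENNReal.tendsto_ofReal ?_
      simpa using (tendsto_pow_atTop_nhds_zero_of_lt_one hq0.le hq1).const_mul
        (ν * (κ ^ p * R ^ n))
    · exact (lintegral_truncation_mono hp v (ball_subset_ball (hrad_lt j).le)
        (hlev_le j)).trans (key j)
  rw [lintegral_eq_zero_iff (by fun_prop)] at hzero
  filter_upwards [hzero] with x hx
  by_contra! hlt
  have : 0 < max (v x - κ) 0 ^ p := Real.rpow_pos_of_pos (lt_max_of_lt_left (by linarith)) _
  simp only [Pi.zero_apply, ENNReal.ofReal_eq_zero] at hx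
  linarith

lemma exists_abs_deGiorgi_criterion {n : ℕ} {s p Λ : ℝ} (hn : 2 ≤ n) (hs : 0 < s) (hs1 : s < 1)
    (hp : 1 < p) (hΛ : 1 ≤ Λ) :
    ∃ ν : ℝ, 0 < ν ∧ ∀ (Ω : Set (Rn n)) (v : Rn n → ℝ) (x₀ : Rn n) (r ρ ρ' κ tl : ℝ),
      IsEnergySol n s p Λ Ω v → 0 < r → ball x₀ r ⊆ Ω → r / 2 ≤ ρ → ρ < ρ' → ρ' ≤ r → 0 < κ →
      0 ≤ tl →
      ∫⁻ y in (ball x₀ (r / 2))ᶜ, ENNReal.ofReal (tailDensity n s p v x₀ y) ≤ ENNReal.ofReal tl →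
      r ^ ((n : ℝ) + s * p) * tl ≤ κ ^ (p - 1) * (ρ' - ρ) ^ n →
      ∫⁻ x in ball x₀ ρ', ENNReal.ofReal (|v x| ^ p) ≤
        ENNReal.ofReal (ν * (κ ^ p * (ρ' - ρ) ^ n)) →
      ∀ᵐ x ∂volume.restrict (ball x₀ ρ), |v x| ≤ κ := by
  obtain ⟨ν, hν, h⟩ := exists_deGiorgi_criterion hn hs hs1 hp hΛ
  refine ⟨ν, hν, ?_⟩
  intro Ω v x₀ r ρ ρ' κ tl hsol hr hΩ hρ hρρ' hρ'r hκ htl0 htl htlκ h_int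
  have hpos : ∀ w : Rn n → ℝ, (∀ x, |w x| = |v x|) →
      ∫⁻ x in ball x₀ ρ', ENNReal.ofReal (max (w x) 0 ^ p) ≤
        ENNReal.ofReal (ν * (κ ^ p * (ρ' - ρ) ^ n)) := fun w hw => by
    refine (lintegral_mono fun x => ENNReal.ofReal_le_ofReal ?_).trans h_int
    rw [← hw x]
    exact Real.rpow_le_rpow (le_max_right _ _) (max_le (le_abs_self _) (abs_nonneg _))
      (by linarith)
  have h1 := h Ω v x₀ r ρ ρ' κ tl hsol hr hΩ hρ hρρ' hρ'r hκ htl0 htl htlκ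
    (hpos v fun x => rfl)
  have h2 := h Ω (fun x => -v x) x₀ r ρ ρ' κ tl hsol.neg hr hΩ hρ hρρ' hρ'r hκ htl0
    (by simpa [tailDensity] using htl) htlκ (hpos _ fun x => abs_neg _)
  filter_upwards [h1, h2] with x hx1 hx2
  exact abs_le.2 ⟨by linarith, hx1⟩

lemma ae_le_of_forall_pos_ae_le_add {β : Type*} [MeasurableSpace β] {μ : Measure β} {f : β → ℝ}
    {a : ℝ} (h : ∀ ε > 0, ∀ᵐ x ∂μ, f x ≤ a + ε) : ∀ᵐ x ∂μ, f x ≤ a := by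
  have h' : ∀ᵐ x ∂μ, ∀ m : ℕ, f x ≤ a + 1 / ((m : ℝ) + 1) :=
    ae_all_iff.2 fun m => h _ (by positivity)
  filter_upwards [h'] with x hx
  refine ge_of_tendsto' (x := atTop) ?_ hx
  simpa using tendsto_one_div_add_atTop_nhds_zero_nat.const_add a

/-- One step of the absorption argument: a bound `M` on a ball improves to a small multiple of `M`
plus a controlled term on a smaller ball. -/
lemma exists_absorption_step {n : ℕ} {s p Λ γ : ℝ} (hn : 2 ≤ n) (hs : 0 < s) (hs1 : s < 1)
    (hp : 1 < p) (hΛ : 1 ≤ Λ) (hγ : γ = (n : ℝ) * p / (p - 1)) :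
    ∃ D : ℝ, 0 < D ∧ ∀ (Ω : Set (Rn n)) (v : Rn n → ℝ) (x₀ : Rn n) (r ρ ρ' tl A G M : ℝ),
      IsEnergySol n s p Λ Ω v → 0 < r → ball x₀ r ⊆ Ω → r / 2 ≤ ρ → ρ < ρ' → ρ' ≤ r →
      0 ≤ tl →
      ∫⁻ y in (ball x₀ (r / 2))ᶜ, ENNReal.ofReal (tailDensity n s p v x₀ y) ≤ ENNReal.ofReal tl →
      0 ≤ A → ∫⁻ x in ball x₀ r, ENNReal.ofReal |v x| ≤ ENNReal.ofReal A →
      0 < G → D * (A / r ^ n + (r ^ (s * p) * tl) ^ (1 / (p - 1))) * r ^ γ ≤ G → 0 ≤ M →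
      (∀ᵐ x ∂volume.restrict (ball x₀ ρ'), |v x| ≤ M) →
      ∀ᵐ x ∂volume.restrict (ball x₀ ρ), |v x| ≤ 2 ^ (-(γ + 1)) * M + G * (ρ' - ρ) ^ (-γ) := by
  obtain ⟨ν, hν, hcrit⟩ := exists_abs_deGiorgi_criterion hn hs hs1 hp hΛ
  have hn0 : (0 : ℝ) < n := by exact_mod_cast (by lia : 0 < n)
  have hp0 : 0 < p - 1 := by linarith
  have hγn : γ = n + n / (p - 1) := by rw [hγ]; field_simp; ring
  set θ : ℝ := 2 ^ (-(γ + 1)) with hθ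
  have hθ0 : 0 < θ := by positivity
  set D := 1 + 1 / (ν * θ ^ (p - 1)) with hD
  have hD1 : 1 ≤ D := le_add_of_nonneg_right (by positivity)
  have hDν : 1 ≤ ν * θ ^ (p - 1) * D := by
    rw [hD, mul_add, mul_one_div_cancel (by positivity)]
    exact le_add_of_nonneg_left (by positivity)
  refine ⟨D, by linarith, ?_⟩
  intro Ω v x₀ r ρ ρ' tl A G M hsol hr hΩ hρ hρρ' hρ'r htl0 htl hA hvA hG hDG hM hvM
  set R := ρ' - ρ with hR
  have hR0 : 0 < R := by linarith
  have hRr : 1 ≤ r / R := by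
    rw [one_le_div hR0]
    linarith
  set T := (r ^ (s * p) * tl) ^ (1 / (p - 1)) with hT
  have hT0 : 0 ≤ T := by positivity
  have hTp : T ^ (p - 1) = r ^ (s * p) * tl := by
    rw [hT, ← Real.rpow_mul (by positivity), one_div_mul_cancel hp0.ne', Real.rpow_one]
  set κ := θ * M + G * R ^ (-γ) with hκ
  have hκ0 : 0 < κ := by positivity
  have hκG : D * (A / r ^ n + T) * (r / R) ^ γ ≤ κ := by
    have : D * (A / r ^ n + T) * r ^ γ * R ^ (-γ) ≤ G * R ^ (-γ) := by gcongr
    rw [Real.div_rpow hr.le hR0.le, div_eq_mul_inv (r ^ γ), ← Real.rpow_neg hR0.le, ← mul_assoc]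
    exact this.trans (le_add_of_nonneg_left (by positivity))
  have hκT : T * (r / R) ^ (n / (p - 1)) ≤ κ := by
    refine le_trans ?_ hκG
    gcongr
    · rw [← one_mul T]
      have : 0 ≤ A / r ^ n := by positivity
      gcongr
      linarith
    · rw [hγn]
      linarith
  have hκA : D * A / R ^ n ≤ κ := by
    refine le_trans ?_ hκG
    calc D * A / R ^ n = D * (A / r ^ n) * (r / R) ^ (n : ℝ) := by
          rw [Real.rpow_natCast, div_pow]
          field_simp
      _ ≤ _ := by
          gcongr
          · linarith
          · rw [hγn]
            exact le_add_of_nonneg_right (by positivity)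
  refine hcrit Ω v x₀ r ρ ρ' κ tl hsol hr hΩ hρ hρρ' hρ'r hκ0 htl0 htl ?_ ?_
  · have h := Real.rpow_le_rpow (by positivity) hκT hp0.le
    rw [Real.mul_rpow hT0 (by positivity), hTp, ← Real.rpow_mul (by positivity),
      div_mul_cancel₀ _ hp0.ne', Real.rpow_natCast, div_pow, ← mul_div_assoc,
      div_le_iff₀ (by positivity)] at h
    rw [Real.rpow_add hr, Real.rpow_natCast]
    linarith
  · calc ∫⁻ x in ball x₀ ρ', ENNReal.ofReal (|v x| ^ p)
        ≤ ∫⁻ x in ball x₀ ρ', ENNReal.ofReal (M ^ (p - 1)) * ENNReal.ofReal |v x| := by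
          refine lintegral_mono_ae ?_
          filter_upwards [hvM] with x hx
          rw [← ENNReal.ofReal_mul (by positivity)]
          refine ENNReal.ofReal_le_ofReal ?_
          rcases (abs_nonneg (v x)).eq_or_lt with h0 | h0
          · rw [← h0, Real.zero_rpow (by linarith), mul_zero]
          · rw [show p = (p - 1) + 1 by ring, Real.rpow_add h0, Real.rpow_one,
              add_sub_cancel_right]
            gcongr
      _ = ENNReal.ofReal (M ^ (p - 1)) * ∫⁻ x in ball x₀ ρ', ENNReal.ofReal |v x| :=
          lintegral_const_mul' _ _ ENNReal.ofReal_ne_top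
      _ ≤ ENNReal.ofReal (M ^ (p - 1)) * ENNReal.ofReal A :=
          mul_le_mul' le_rfl ((lintegral_mono_set (ball_subset_ball hρ'r)).trans hvA)
      _ ≤ _ := by
          rw [← ENNReal.ofReal_mul (by positivity)]
          refine ENNReal.ofReal_le_ofReal ?_
          have h1 : (θ * M) ^ (p - 1) ≤ κ ^ (p - 1) := by
            gcongr
            exact le_add_of_nonneg_right (by positivity)
          have h2 : κ ^ p = κ ^ (p - 1) * κ := by
            rw [← Real.rpow_add_one hκ0.ne', sub_add_cancel]
          calc M ^ (p - 1) * A = 1 * (M ^ (p - 1) * A) := (one_mul _).symm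
            _ ≤ ν * θ ^ (p - 1) * D * (M ^ (p - 1) * A) := by gcongr
            _ = ν * ((θ * M) ^ (p - 1) * (D * A / R ^ n) * R ^ n) := by
                rw [Real.mul_rpow hθ0.le hM]
                field_simp
            _ ≤ ν * (κ ^ (p - 1) * κ * R ^ n) := by gcongr
            _ = _ := by rw [h2]

/-- Iterating the absorption step removes the a priori bound `M`. -/
lemma ae_le_of_absorption_step {n : ℕ} {v : Rn n → ℝ} {x₀ : Rn n} {r₀ r' γ G M : ℝ}
    (hG : 0 < G) (hM : 0 ≤ M)
    (hstep : ∀ ρ ρ' L : ℝ, r₀ ≤ ρ → ρ < ρ' → ρ' ≤ r' → 0 ≤ L →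
      (∀ᵐ x ∂volume.restrict (ball x₀ ρ'), |v x| ≤ L) →
      ∀ᵐ x ∂volume.restrict (ball x₀ ρ), |v x| ≤ 2 ^ (-(γ + 1)) * L + G * (ρ' - ρ) ^ (-γ))
    (hγ : 0 < γ) (hvM : ∀ᵐ x ∂volume.restrict (ball x₀ r'), |v x| ≤ M)
    {ρ : ℝ} (hρ : r₀ ≤ ρ) (hρr : ρ < r') :
    ∀ᵐ x ∂volume.restrict (ball x₀ ρ), |v x| ≤ 2 ^ (γ + 1) * G * (r' - ρ) ^ (-γ) := by
  set θ : ℝ := 2 ^ (-(γ + 1)) with hθ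
  have hθ0 : 0 < θ := by positivity
  have hθ1 : θ < 1 := Real.rpow_lt_one_of_one_lt_of_neg one_lt_two (by linarith)
  have hθγ : θ * 2 ^ (γ + 1) = 1 := by
    rw [hθ, ← Real.rpow_add two_pos, neg_add_cancel, Real.rpow_zero]
  have key : ∀ (i : ℕ) (ρ : ℝ), r₀ ≤ ρ → ρ < r' → ∀ᵐ x ∂volume.restrict (ball x₀ ρ),
      |v x| ≤ 2 ^ (γ + 1) * G * (r' - ρ) ^ (-γ) + θ ^ i * M := by
    intro i
    induction i with
    | zero =>
      intro ρ hρ hρr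
      filter_upwards [ae_restrict_of_ae_restrict_of_subset (ball_subset_ball hρr.le) hvM]
        with x hx
      have : 0 < r' - ρ := by linarith
      rw [pow_zero, one_mul]
      exact hx.trans (le_add_of_nonneg_left (by positivity))
    | succ i ih =>
      intro ρ hρ hρr
      have hd : 0 < r' - ρ := by linarith
      have h1 := ih ((ρ + r') / 2) (by linarith) (by linarith)
      rw [show r' - (ρ + r') / 2 = (r' - ρ) / 2 by ring] at h1
      have h2 := hstep ρ ((ρ + r') / 2) _ hρ (by linarith) (by linarith) (by positivity) h1
      rw [show (ρ + r') / 2 - ρ = (r' - ρ) / 2 by ring] at h2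
      filter_upwards [h2] with x hx
      refine hx.trans (le_of_eq ?_)
      rw [Real.div_rpow hd.le zero_le_two, Real.rpow_neg zero_le_two, div_inv_eq_mul, pow_succ]
      have h2γ : (2 : ℝ) ^ (γ + 1) = 2 ^ γ * 2 := Real.rpow_add_one two_ne_zero γ
      linear_combination (G * (r' - ρ) ^ (-γ) * 2 ^ γ) * hθγ
        - G * (r' - ρ) ^ (-γ) * h2γ
  refine ae_le_of_forall_pos_ae_le_add fun ε hε => ?_
  have hlim : Tendsto (fun i : ℕ => θ ^ i * M) atTop (𝓝 0) := by
    simpa using (tendsto_pow_atTop_nhds_zero_of_lt_one hθ0.le hθ1).mul_const M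
  obtain ⟨i, hi⟩ := (hlim.eventually_lt_const hε).exists
  filter_upwards [key i ρ hρ hρr] with x hx
  linarith

/-- A finite-energy solution is bounded on every smaller concentric ball. -/
lemma IsEnergySol.exists_ae_le {n : ℕ} {s p Λ : ℝ} (hn : 2 ≤ n) (hs : 0 < s) (hs1 : s < 1)
    (hp : 1 < p) (hΛ : 1 ≤ Λ) {Ω : Set (Rn n)} {v : Rn n → ℝ} (hsol : IsEnergySol n s p Λ Ω v)
    {x₀ : Rn n} {r r' tl : ℝ} (hr : 0 < r) (hΩ : ball x₀ r ⊆ Ω) (hr' : r / 2 ≤ r') (hr'r : r' < r)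
    (htl0 : 0 ≤ tl)
    (htl : ∫⁻ y in (ball x₀ (r / 2))ᶜ, ENNReal.ofReal (tailDensity n s p v x₀ y) ≤
      ENNReal.ofReal tl) :
    ∃ M, 0 ≤ M ∧ ∀ᵐ x ∂volume.restrict (ball x₀ r'), |v x| ≤ M := by
  obtain ⟨ν, hν, hcrit⟩ := exists_abs_deGiorgi_criterion hn hs hs1 hp hΛ
  have hp0 : 0 < p - 1 := by linarith
  have hR : 0 < r - r' := by linarith
  set P := (∫⁻ x, ENNReal.ofReal (|v x| ^ p)).toReal with hP
  have hP0 : 0 ≤ P := ENNReal.toReal_nonneg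
  set κ₁ := (P / (ν * (r - r') ^ n)) ^ (1 / p) with hκ₁
  set κ₂ := (r ^ ((n : ℝ) + s * p) * tl / (r - r') ^ n) ^ (1 / (p - 1)) with hκ₂
  have hκ₁0 : 0 ≤ κ₁ := by positivity
  have hκ₂0 : 0 ≤ κ₂ := by positivity
  have hκ : 0 < 1 + κ₁ + κ₂ := by positivity
  refine ⟨1 + κ₁ + κ₂, hκ.le, ?_⟩
  refine hcrit Ω v x₀ r r' r _ tl hsol hr hΩ hr' hr'r le_rfl hκ htl0 htl ?_ ?_
  · have h : κ₂ ^ (p - 1) ≤ (1 + κ₁ + κ₂) ^ (p - 1) := by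
      gcongr
      linarith
    rw [hκ₂, ← Real.rpow_mul (by positivity), one_div_mul_cancel hp0.ne', Real.rpow_one,
      div_le_iff₀ (by positivity)] at h
    exact h
  · have h : κ₁ ^ p ≤ (1 + κ₁ + κ₂) ^ p := by
      gcongr
      linarith
    rw [hκ₁, ← Real.rpow_mul (by positivity), one_div_mul_cancel (by positivity), Real.rpow_one,
      div_le_iff₀ (by positivity)] at h
    calc ∫⁻ x in ball x₀ r, ENNReal.ofReal (|v x| ^ p) ≤ ∫⁻ x, ENNReal.ofReal (|v x| ^ p) :=
          setLIntegral_le_lintegral _ _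
      _ = ENNReal.ofReal P := (ENNReal.ofReal_toReal hsol.2.1.ne).symm
      _ ≤ _ := ENNReal.ofReal_le_ofReal (by linarith)

lemma exists_local_bound {n : ℕ} {s p Λ : ℝ} (hn : 2 ≤ n) (hs : 0 < s) (hs1 : s < 1)
    (hp : 1 < p) (hΛ : 1 ≤ Λ) :
    ∃ C : ℝ, 0 < C ∧ ∀ (Ω : Set (Rn n)) (v : Rn n → ℝ) (x₀ : Rn n) (r σ tl A : ℝ),
      IsEnergySol n s p Λ Ω v → 0 < r → ball x₀ r ⊆ Ω → 0 < σ → σ < 1 → 0 ≤ tl →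
      ∫⁻ y in (ball x₀ (r / 2))ᶜ, ENNReal.ofReal (tailDensity n s p v x₀ y) ≤ ENNReal.ofReal tl →
      0 ≤ A → ∫⁻ x in ball x₀ r, ENNReal.ofReal |v x| ≤ ENNReal.ofReal A →
      ∀ᵐ x ∂volume.restrict (ball x₀ (σ * r)),
        |v x| ≤ C / (1 - σ) ^ ((n : ℝ) * p / (p - 1)) *
          (A / r ^ n + (r ^ (s * p) * tl) ^ (1 / (p - 1))) := by
  set γ := (n : ℝ) * p / (p - 1) with hγ
  have hp0 : 0 < p - 1 := by linarith
  have hn0 : (0 : ℝ) < n := by exact_mod_cast (by lia : 0 < n)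
  have hγ0 : 0 < γ := by positivity
  obtain ⟨D, hD, hstep⟩ := exists_absorption_step hn hs hs1 hp hΛ hγ
  refine ⟨2 ^ (γ + 1) * D * 4 ^ γ, by positivity, ?_⟩
  intro Ω v x₀ r σ tl A hsol hr hΩ hσ hσ1 htl0 htl hA hvA
  set X := A / r ^ n + (r ^ (s * p) * tl) ^ (1 / (p - 1)) with hX
  have hX0 : 0 ≤ X := by positivity
  have hσ0 : 0 < 1 - σ := by linarith
  set σ' := max σ (1 / 2) with hσ'
  have hσ'1 : σ' < 1 := max_lt hσ1 (by norm_num)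
  have hσσ' : σ ≤ σ' := le_max_left _ _
  have hσ'2 : 1 / 2 ≤ σ' := le_max_right _ _
  have hσ'3 : (1 - σ) / 2 ≤ 1 - σ' := by
    have : σ' ≤ (1 + σ) / 2 := max_le (by linarith) (by linarith)
    linarith
  have hρ₁ : r / 2 ≤ σ' * r := by nlinarith
  have hρ₂ : σ' * r < (1 + σ') * r / 2 := by nlinarith
  have hρ₃ : (1 + σ') * r / 2 < r := by nlinarith
  obtain ⟨M, hM, hvM⟩ := hsol.exists_ae_le hn hs hs1 hp hΛ hr hΩ (hρ₁.trans hρ₂.le) hρ₃ htl0 htl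
  set S := (2 : ℝ) ^ (γ + 1) * 4 ^ γ / (1 - σ) ^ γ with hS
  have hS0 : 0 < S := by positivity
  refine ae_le_of_forall_pos_ae_le_add fun ε hε => ?_
  set G := (D * X + ε / S) * r ^ γ with hG
  have hG0 : 0 < G := by positivity
  have h := ae_le_of_absorption_step (v := v) (x₀ := x₀) (r₀ := r / 2) (γ := γ) hG0 hM
    (fun ρ ρ' L h1 h2 h3 h4 h5 => hstep Ω v x₀ r ρ ρ' tl A G L hsol hr hΩ h1 h2 (h3.trans hρ₃.le)
      htl0 htl hA hvA hG0 (by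
        rw [hG]
        gcongr
        exact le_add_of_nonneg_right (by positivity)) h4 h5) hγ0 hvM hρ₁ hρ₂
  have hsub : ball x₀ (σ * r) ⊆ ball x₀ (σ' * r) := ball_subset_ball (by gcongr)
  filter_upwards [ae_restrict_of_ae_restrict_of_subset hsub h] with x hx
  refine hx.trans ?_
  have h1 : ((1 + σ') * r / 2 - σ' * r) ^ (-γ) ≤ ((1 - σ) * r / 4) ^ (-γ) := by
    refine Real.rpow_le_rpow_of_nonpos (by positivity) ?_ (by linarith)
    nlinarith
  calc _ ≤ 2 ^ (γ + 1) * G * ((1 - σ) * r / 4) ^ (-γ) := by gcongr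
    _ = S * (D * X + ε / S) := by
      rw [Real.rpow_neg (by positivity), Real.div_rpow (by positivity) (by norm_num),
        Real.mul_rpow hσ0.le hr.le, hG, hS]
      field_simp
    _ = _ := by
      rw [mul_add, mul_div_cancel₀ _ hS0.ne', hS]
      ring

lemma WeakSol.isEnergySol_mk {n : ℕ} {s p Λ : ℝ} {Φ : ℝ → ℝ} {K : Rn n → Rn n → ℝ}
    {Ω : Set (Rn n)} {g v : Rn n → ℝ} (hΦ : PhiBounds Λ p Φ) (hK : KernelBounds n Λ s p K)
    (h : WeakSol n Φ K s p Ω (fun _ => 0) g v) (hv : AEMeasurable v) :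
    IsEnergySol n s p Λ Ω (hv.mk v) := by
  obtain ⟨⟨-, hvp, hg⟩, -, hsol⟩ := h
  have e := hv.ae_eq_mk
  refine ⟨hv.measurable_mk, ?_, ?_, Φ, K, hΦ, hK, fun φ hφ => ?_⟩
  · rw [Measure.restrict_univ] at hvp
    convert hvp using 1
    refine lintegral_congr_ae ?_
    filter_upwards [e] with x hx
    rw [hx]
  · convert hg using 1
    unfold gagliardo
    rw [Measure.restrict_univ]
    refine lintegral_congr_ae ?_
    filter_upwards [e] with x hx
    refine lintegral_congr_ae ?_
    filter_upwards [e] with y hy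
    rw [hx, hy]
  · have h0 := hsol φ hφ
    simp only [mul_zero, integral_zero] at h0
    rw [← h0]
    refine integral_congr_ae ?_
    filter_upwards [e] with x hx
    refine integral_congr_ae ?_
    filter_upwards [e] with y hy
    rw [hx, hy]

lemma tailFn_congr_ae {n : ℕ} {s p : ℝ} {v w : Rn n → ℝ} (h : v =ᵐ[volume] w) (x₀ : Rn n)
    (r : ℝ) : tailFn n s p v x₀ r = tailFn n s p w x₀ r := by
  unfold tailFn
  congr 2
  refine lintegral_congr_ae (ae_restrict_of_ae ?_)
  filter_upwards [h] with x hx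
  rw [hx]

lemma IsEnergySol.integrableOn_ball {n : ℕ} {s p Λ : ℝ} (hp : 1 < p) {Ω : Set (Rn n)}
    {v : Rn n → ℝ} (hsol : IsEnergySol n s p Λ Ω v) (x₀ : Rn n) (r : ℝ) :
    IntegrableOn v (ball x₀ r) := by
  have hv := hsol.1
  refine ⟨hv.aestronglyMeasurable, ?_⟩
  calc ∫⁻ x in ball x₀ r, ‖v x‖ₑ
      ≤ ∫⁻ x in ball x₀ r, (1 + ENNReal.ofReal (|v x| ^ p)) := by
        refine lintegral_mono fun x => ?_
        rw [← ENNReal.ofReal_one, ← ENNReal.ofReal_add zero_le_one (by positivity),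
          Real.enorm_eq_ofReal_abs]
        refine ENNReal.ofReal_le_ofReal ?_
        rcases le_total |v x| 1 with h | h
        · exact h.trans (le_add_of_nonneg_right (by positivity))
        · exact (Real.self_le_rpow_of_one_le h hp.le).trans (le_add_of_nonneg_left zero_le_one)
    _ = volume (ball x₀ r) + ∫⁻ x in ball x₀ r, ENNReal.ofReal (|v x| ^ p) := by
        rw [lintegral_add_left measurable_const, setLIntegral_one]
    _ < ⊤ := ENNReal.add_lt_top.2 ⟨measure_ball_lt_top,
        (setLIntegral_le_lintegral _ _).trans_lt hsol.2.1⟩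

lemma exists_essSup_bound {n : ℕ} {s p Λ : ℝ} (hn : 2 ≤ n) (hs : 0 < s) (hs1 : s < 1)
    (hp : 1 < p) (hΛ : 1 ≤ Λ) :
    ∃ c : ℝ, 0 < c ∧ ∀ (Ω : Set (Rn n)) (v : Rn n → ℝ) (x₀ : Rn n) (r : ℝ),
      IsEnergySol n s p Λ Ω v → 0 < r → ball x₀ r ⊆ Ω → ∀ σ : ℝ, 0 < σ → σ < 1 →
        essSup (fun x => ENNReal.ofReal |v x|) (volume.restrict (ball x₀ (σ * r))) ≤
          ENNReal.ofReal (c / (1 - σ) ^ ((n : ℝ) * p / (p - 1))) *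
            (ENNReal.ofReal (⨍ x in ball x₀ r, |v x|) + tailFn n s p v x₀ (r / 2)) := by
  obtain ⟨C, hC, hbound⟩ := exists_local_bound hn hs hs1 hp hΛ
  have hp0 : 0 < p - 1 := by linarith
  have : Nontrivial (Rn n) := by
    have : Nonempty (Fin n) := ⟨⟨0, by lia⟩⟩
    infer_instance
  set ω : ℝ := (volume (ball (0 : Rn n) 1)).toReal with hω
  have hω0 : 0 < ω := ENNReal.toReal_pos (measure_ball_pos _ _ one_pos).ne'
    measure_ball_lt_top.ne
  set e : ℝ := (2 ^ (s * p)) ^ (1 / (p - 1)) with he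
  have he0 : 0 < e := by positivity
  refine ⟨C * (ω + e), by positivity, ?_⟩
  intro Ω v x₀ r hsol hr hΩ σ hσ hσ1
  have hσ0 : 0 < 1 - σ := by linarith
  set c := C * (ω + e) / (1 - σ) ^ ((n : ℝ) * p / (p - 1)) with hc
  have hc0 : 0 < c := by positivity
  set J := ∫⁻ y in (ball x₀ (r / 2))ᶜ, ENNReal.ofReal (tailDensity n s p v x₀ y) with hJ
  have htail : tailFn n s p v x₀ (r / 2) =
      (ENNReal.ofReal ((r / 2) ^ (s * p)) * J) ^ (1 / (p - 1)) := rfl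
  rcases eq_or_ne J ⊤ with hJt | hJt
  · have h0 : ENNReal.ofReal ((r / 2) ^ (s * p)) ≠ 0 :=
      (ENNReal.ofReal_pos.2 (by positivity)).ne'
    rw [htail, hJt, ENNReal.mul_top h0, ENNReal.top_rpow_of_pos (by positivity), add_top,
      ENNReal.mul_top (ENNReal.ofReal_pos.2 hc0).ne']
    exact le_top
  set tl := J.toReal with htl
  have htl0 : 0 ≤ tl := ENNReal.toReal_nonneg
  have hJtl : J = ENNReal.ofReal tl := (ENNReal.ofReal_toReal hJt).symm
  set A := ∫ x in ball x₀ r, |v x| with hA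
  have hA0 : 0 ≤ A := integral_nonneg fun x => abs_nonneg _
  have hvA : ∫⁻ x in ball x₀ r, ENNReal.ofReal |v x| = ENNReal.ofReal A :=
    (ofReal_integral_eq_lintegral_ofReal (hsol.integrableOn_ball hp x₀ r).abs
      (ae_of_all _ fun x => abs_nonneg _)).symm
  have havg : ⨍ x in ball x₀ r, |v x| = A / (ω * r ^ n) := by
    rw [setAverage_eq, smul_eq_mul, Measure.real, Measure.addHaar_ball _ _ hr.le,
      finrank_euclideanSpace, Fintype.card_fin, ENNReal.toReal_mul,
      ENNReal.toReal_ofReal (by positivity), mul_comm ω, inv_mul_eq_div]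
  set T := ((r / 2) ^ (s * p) * tl) ^ (1 / (p - 1)) with hT
  have hT0 : 0 ≤ T := by positivity
  have hTe : (r ^ (s * p) * tl) ^ (1 / (p - 1)) = e * T := by
    rw [he, hT, ← Real.mul_rpow (by positivity) (by positivity), ← mul_assoc,
      ← Real.mul_rpow zero_le_two (by positivity), mul_div_cancel₀ _ two_ne_zero]
  have htailT : tailFn n s p v x₀ (r / 2) = ENNReal.ofReal T := by
    rw [htail, hJtl, ← ENNReal.ofReal_mul (by positivity),
      ENNReal.ofReal_rpow_of_nonneg (by positivity) (by positivity)]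
  rw [htailT, havg, ← ENNReal.ofReal_add (by positivity) hT0, ← ENNReal.ofReal_mul hc0.le]
  refine essSup_le_of_ae_le _ ?_
  filter_upwards [hbound Ω v x₀ r σ tl A hsol hr hΩ hσ hσ1 htl0 hJtl.le hA0 hvA.le] with x hx
  refine ENNReal.ofReal_le_ofReal (hx.trans ?_)
  rw [hTe, hc, mul_div_right_comm C (ω + e), mul_assoc (C / _)]
  gcongr
  have h1 : A / r ^ n = ω * (A / (ω * r ^ n)) := by field_simp
  have h2 : 0 ≤ A / (ω * r ^ n) := by positivity
  rw [h1]
  nlinarith [mul_nonneg hω0.le hT0, mul_nonneg he0.le h2]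

/-- Corollary 2.1, Local boundedness. -/
theorem local_boundedness
    (n : ℕ) (s p Λ : ℝ)
    (hn : 2 ≤ n) (hs : 0 < s) (hs1 : s < 1) (hp1 : 1 < p) (hΛ : 1 ≤ Λ) :
    ∃ c : ℝ, 0 < c ∧
      ∀ (Φ : ℝ → ℝ) (K : Rn n → Rn n → ℝ) (Ω : Set (Rn n)) (g v : Rn n → ℝ)
        (x₀ : Rn n) (r : ℝ),
        KernelBounds n Λ s p K → PhiBounds Λ p Φ → IsOpen Ω →
        memWsp n s p univ g →
        WeakSol n Φ K s p Ω (fun _ => 0) g v →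
        0 < r → ball x₀ r ⊆ Ω →
        ∀ σ : ℝ, 0 < σ → σ < 1 →
          essSup (fun x => ENNReal.ofReal |v x|) (volume.restrict (ball x₀ (σ * r))) ≤
            ENNReal.ofReal (c / (1 - σ) ^ ((n : ℝ) * p / (p - 1))) *
              (ENNReal.ofReal (⨍ x in ball x₀ r, |v x|) + tailFn n s p v x₀ (r / 2)) := by
  obtain ⟨c, hc, h⟩ := exists_essSup_bound hn hs hs1 hp1 hΛ
  refine ⟨c, hc, ?_⟩
  intro Φ K Ω g v x₀ r hK hΦ _ _ hsol hr hΩ σ hσ hσ1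
  have hv : AEMeasurable v := by simpa using hsol.1.1
  have e := hv.ae_eq_mk
  have h1 := h Ω (hv.mk v) x₀ r (hsol.isEnergySol_mk hΦ hK hv) hr hΩ σ hσ hσ1
  have h2 : essSup (fun x => ENNReal.ofReal |v x|) (volume.restrict (ball x₀ (σ * r))) =
      essSup (fun x => ENNReal.ofReal |hv.mk v x|) (volume.restrict (ball x₀ (σ * r))) := by
    refine essSup_congr_ae (ae_restrict_of_ae ?_)
    filter_upwards [e] with x hx
    rw [← hx]
  have h3 : ⨍ x in ball x₀ r, |v x| = ⨍ x in ball x₀ r, |hv.mk v x| := by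
    refine average_congr (ae_restrict_of_ae ?_)
    filter_upwards [e] with x hx
    rw [← hx]
  rw [h2, h3, tailFn_congr_ae e]
  exact h1
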